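/- arXiv:1704.00152 — 4 statements merged into one kernel-verified Lean document; each statement's English description precedes it below -/
import Mathlib

section
/- Let G be a connected bipartite graph with bipartition V_1 ⊔ V_2 satisfying c_G(S) = |S| + 1 for every cut set S, and let v_1, v_2 be the neighbours of the two leaves. If {v_1, v_2} is an edge of G, then |V_1| = |V_2| = m, each of v_1 and v_2 has degree m, and v_1, v_2 are the only cut vertices of G. -/
open SimpleGraph Finset

/-- Number of connected components of the subgraph of `G` induced on the complement of `S`. -/
noncomputable def numComp {V : Type*} [Fintype V] (G : SimpleGraph V) (S : Finset V) : ℕ :=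
  Nat.card (G.induce ((↑S : Set V)ᶜ)).ConnectedComponent

/-- `S` is a cut set of `G`. -/
def IsCutSet {V : Type*} [Fintype V] [DecidableEq V] (G : SimpleGraph V) (S : Finset V) : Prop :=
  S = ∅ ∨ (S ≠ ∅ ∧ ∀ i ∈ S, numComp G (S.erase i) < numComp G S)

/-- The combinatorial condition equivalent to unmixedness of the binomial edge ideal. -/
def Unmixed {V : Type*} [Fintype V] [DecidableEq V] (G : SimpleGraph V) : Prop :=
  ∀ S : Finset V, IsCutSet G S → numComp G S = S.card + 1

/-- Adjacency-constant labels are constant on reachable pairs. -/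
lemma aux_label_reach {V L : Type*} (G : SimpleGraph V) (S : Set V) (φ : V → L)
    (hφ : ∀ a b, a ∉ S → b ∉ S → G.Adj a b → φ a = φ b)
    (a b : (Sᶜ : Set V)) (h : (G.induce Sᶜ).Reachable a b) : φ a = φ b := by
  obtain ⟨w⟩ := h
  induction w with
  | nil => rfl
  | cons hadj _ ih =>
    rename_i u v w _
    exact (hφ u v u.2 v.2 hadj).trans ih

lemma aux_lower {V L : Type*} [Fintype V] (G : SimpleGraph V) (S R : Finset V)
    (φ : V → L) (hφ : ∀ a b, a ∉ S → b ∉ S → G.Adj a b → φ a = φ b)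
    (hR : ∀ r ∈ R, r ∉ S) (hinj : ∀ a ∈ R, ∀ b ∈ R, φ a = φ b → a = b) :
    R.card ≤ numComp G S := by
  classical
  have h1 : Nat.card R = R.card := by simp
  rw [← h1]
  unfold numComp
  refine Nat.card_le_card_of_injective
    (fun r : R => (G.induce ((↑S : Set V)ᶜ)).connectedComponentMk
      ⟨r.1, by simpa using hR r.1 r.2⟩) ?_
  intro a b hab
  have := aux_label_reach G (↑S : Set V) φ (by simpa using hφ) _ _
    (ConnectedComponent.exact hab)
  exact Subtype.ext (hinj _ a.2 _ b.2 this)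

lemma aux_upper {V : Type*} [Fintype V] (G : SimpleGraph V) (S R : Finset V)
    (hR : ∀ v, ∀ hv : v ∉ S, ∃ r ∈ R, ∃ hr : r ∉ S,
      (G.induce ((↑S : Set V)ᶜ)).Reachable ⟨r, by simpa using hr⟩ ⟨v, by simpa using hv⟩) :
    numComp G S ≤ R.card := by
  classical
  have h1 : Nat.card (R.filter (· ∉ S) : Finset V) = (R.filter (· ∉ S)).card := by
    rw [Nat.card_eq_fintype_card, Fintype.card_coe]
  refine le_trans ?_ (Finset.card_filter_le R (· ∉ S))
  rw [← h1]
  unfold numComp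
  refine Nat.card_le_card_of_surjective
    (fun r : (R.filter (· ∉ S) : Finset V) => (G.induce ((↑S : Set V)ᶜ)).connectedComponentMk
      ⟨r.1, by simpa using (Finset.mem_filter.1 r.2).2⟩) ?_
  intro c
  induction c using ConnectedComponent.ind with
  | _ v =>
    obtain ⟨r, hr, hrS, hreach⟩ := hR v.1 (fun h => v.2 (Finset.mem_coe.2 h))
    exact ⟨⟨r, Finset.mem_filter.2 ⟨hr, hrS⟩⟩, ConnectedComponent.sound hreach⟩

lemma aux_cutset {V L : Type*} [Fintype V] [DecidableEq V] (G : SimpleGraph V) (S : Finset V)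
    (φ : V → L) (hφ : ∀ a b, a ∉ S → b ∉ S → G.Adj a b → φ a = φ b)
    (hS : ∀ s ∈ S, ∃ a b, a ∉ S ∧ b ∉ S ∧ G.Adj s a ∧ G.Adj s b ∧ φ a ≠ φ b) :
    IsCutSet G S := by
  classical
  rcases eq_or_ne S ∅ with h | h
  · exact Or.inl h
  refine Or.inr ⟨h, fun s hs => ?_⟩
  obtain ⟨a, b, ha, hb, hsa, hsb, hab⟩ := hS s hs
  have hsub : ((↑S : Set V)ᶜ) ⊆ ((↑(S.erase s) : Set V)ᶜ) := by
    intro x hx h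
    exact hx (Finset.mem_coe.2 (Finset.mem_of_mem_erase (Finset.mem_coe.1 h)))
  let ι : G.induce ((↑S : Set V)ᶜ) →g G.induce ((↑(S.erase s) : Set V)ᶜ) :=
    (SimpleGraph.induceHomOfLE G hsub).toHom
  let F := ConnectedComponent.map ι
  have hs' : s ∈ ((↑(S.erase s) : Set V)ᶜ) := by simp
  let s' : ((↑(S.erase s) : Set V)ᶜ : Set V) := ⟨s, hs'⟩
  let a' : ((↑S : Set V)ᶜ : Set V) := ⟨a, by simpa using ha⟩
  let b' : ((↑S : Set V)ᶜ : Set V) := ⟨b, by simpa using hb⟩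
  have hFa : F ((G.induce _).connectedComponentMk a') = (G.induce _).connectedComponentMk s' := by
    refine ConnectedComponent.sound (Adj.reachable ?_)
    exact hsa.symm
  have hFb : F ((G.induce _).connectedComponentMk b') = (G.induce _).connectedComponentMk s' := by
    refine ConnectedComponent.sound (Adj.reachable ?_)
    exact hsb.symm
  have hsurj : Function.Surjective F := by
    intro c
    induction c using ConnectedComponent.ind with
    | _ v =>
      by_cases hv : v.1 = s
      · refine ⟨_, hFa.trans ?_⟩
        congr 1
        exact Subtype.ext hv.symm
      · have hv2 : v.1 ∉ S := by
          intro h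
          exact v.2 (Finset.mem_coe.2 (Finset.mem_erase.2 ⟨hv, h⟩))
        exact ⟨(G.induce _).connectedComponentMk ⟨v.1, by simpa using hv2⟩, rfl⟩
  have hninj : ¬ Function.Injective F := by
    intro hinj
    have := hinj (hFa.trans hFb.symm)
    exact hab (aux_label_reach G (↑S : Set V) φ (by simpa using hφ) a' b'
      (ConnectedComponent.exact this))
  unfold numComp
  refine lt_of_le_of_ne (Nat.card_le_card_of_surjective F hsurj) ?_
  intro heq
  exact hninj ((Nat.bijective_iff_surjective_and_card F).2 ⟨hsurj, heq.symm⟩).1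

lemma aux_other {V : Type*} [Fintype V] [DecidableEq V] (G : SimpleGraph V)
    [DecidableRel G.Adj] (v a : V) (h : G.Adj v a) (hd : G.degree v ≠ 1) :
    ∃ b, G.Adj v b ∧ b ≠ a := by
  by_contra! hcon
  apply hd
  rw [← G.card_neighborFinset_eq_degree, Finset.card_eq_one]
  refine ⟨a, ?_⟩
  ext x
  simp only [mem_neighborFinset, Finset.mem_singleton]
  exact ⟨hcon x, fun hx => hx ▸ h⟩

lemma aux_leaf {V : Type*} [Fintype V] [DecidableEq V] (G : SimpleGraph V)
    [DecidableRel G.Adj] (v a b : V) (ha : G.Adj v a) (hb : G.Adj v b) (hd : G.degree v = 1) :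
    a = b := by
  rw [← G.card_neighborFinset_eq_degree, Finset.card_eq_one] at hd
  obtain ⟨c, hc⟩ := hd
  have h1 : a ∈ G.neighborFinset v := by simpa using ha
  have h2 : b ∈ G.neighborFinset v := by simpa using hb
  rw [hc] at h1 h2
  simp at h1 h2
  rw [h1, h2]

/-- Removing all non-leaves of one side. -/
lemma aux_side {V : Type*} [Fintype V] [DecidableEq V] (G : SimpleGraph V)
    [DecidableRel G.Adj] (V1 V2 : Finset V)
    (hdisj : ∀ v, v ∈ V1 → v ∉ V2) (hcover : ∀ v, v ∈ V1 ∨ v ∈ V2)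
    (hbip : ∀ a b, G.Adj a b → (a ∈ V1 ∧ b ∈ V2) ∨ (a ∈ V2 ∧ b ∈ V1))
    (hnb : ∀ v, ∃ u, G.Adj v u) (hunmixed : Unmixed G) :
    V2.card = (V1.filter (fun v => G.degree v ≠ 1)).card + 1 := by
  classical
  choose nb hnb using hnb
  set S := V1.filter (fun v => G.degree v ≠ 1) with hS
  have memS : ∀ v, v ∈ S ↔ v ∈ V1 ∧ G.degree v ≠ 1 := by intro v; simp [hS]
  let φ : V → V := fun v => if v ∈ V2 then v else nb v
  have key : ∀ a b, a ∈ V1 → b ∈ V2 → a ∉ S → G.Adj a b → φ a = φ b := by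
    intro a b ha hb haS hab
    have hd : G.degree a = 1 := by
      by_contra h; exact haS ((memS a).2 ⟨ha, h⟩)
    simp only [φ, hb, hdisj a ha, if_true, if_false]
    exact aux_leaf G a _ _ (hnb a) hab hd
  have hφ : ∀ a b, a ∉ S → b ∉ S → G.Adj a b → φ a = φ b := by
    intro a b ha hb hab
    rcases hbip a b hab with ⟨h1, h2⟩ | ⟨h1, h2⟩
    · exact key a b h1 h2 ha hab
    · exact (key b a h2 h1 hb hab.symm).symm
  have h2S : ∀ v ∈ V2, v ∉ S := fun v hv h => hdisj v ((memS v).1 h).1 hv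
  have h12 : ∀ a b, G.Adj a b → a ∈ V1 → b ∈ V2 := by
    intro a b hab ha
    rcases hbip a b hab with h | h
    · exact h.2
    · exact absurd h.1 (hdisj a ha)
  have hcut : IsCutSet G S := by
    refine aux_cutset G S φ hφ ?_
    intro s hs
    obtain ⟨hs1, hs2⟩ := (memS s).1 hs
    obtain ⟨b, hb, hne⟩ := aux_other G s (nb s) (hnb s) hs2
    have ha2 := h12 _ _ (hnb s) hs1
    have hb2 := h12 _ _ hb hs1
    refine ⟨nb s, b, h2S _ ha2, h2S _ hb2, hnb s, hb, ?_⟩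
    simp only [φ, ha2, hb2, if_true]
    exact hne.symm
  rw [← hunmixed S hcut]
  apply le_antisymm
  · refine aux_lower G S V2 φ hφ h2S ?_
    intro a ha b hb h
    simpa [φ, ha, hb] using h
  · refine aux_upper G S V2 ?_
    intro v hv
    rcases hcover v with h | h
    · have h2 := h12 _ _ (hnb v) h
      refine ⟨nb v, h2, h2S _ h2, Adj.reachable ?_⟩
      exact (hnb v).symm
    · exact ⟨v, h, hv, Reachable.refl _⟩

lemma aux_half {V : Type*} [Fintype V] [DecidableEq V] (G : SimpleGraph V)
    [DecidableRel G.Adj] (V1 V2 : Finset V)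
    (hdisj : ∀ v, v ∈ V1 → v ∉ V2) (hcover : ∀ v, v ∈ V1 ∨ v ∈ V2)
    (hbip : ∀ a b, G.Adj a b → (a ∈ V1 ∧ b ∈ V2) ∨ (a ∈ V2 ∧ b ∈ V1))
    (hnb : ∀ v, ∃ u, G.Adj v u) (hunmixed : Unmixed G) (hcard : V1.card = V2.card)
    (f1 f2 v1 v2 : V) (hl1 : G.degree f1 = 1) (hl2 : G.degree f2 = 1)
    (ha1 : G.Adj f1 v1) (ha2 : G.Adj f2 v2) (hadj : G.Adj v1 v2) (hv1 : v1 ∈ V1)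
    (hu1 : ∀ v ∈ V1, G.degree v = 1 → v = f2) (hu2 : ∀ v ∈ V2, G.degree v = 1 → v = f1) :
    ∀ x ∈ V2, G.Adj v1 x := by
  classical
  by_contra! hcon
  obtain ⟨x0, hx0, hx0a⟩ := hcon
  have h12 : ∀ a b, G.Adj a b → a ∈ V1 → b ∈ V2 := by
    intro a b hab ha
    rcases hbip a b hab with h | h
    · exact h.2
    · exact absurd h.1 (hdisj a ha)
  have h21 : ∀ a b, G.Adj a b → a ∈ V2 → b ∈ V1 := by
    intro a b hab ha
    rcases hbip a b hab with h | h
    · exact absurd ha (hdisj a h.1)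
    · exact h.2
  set X := V2.filter (fun x => ¬ G.Adj v1 x) with hX
  have memX : ∀ v, v ∈ X ↔ v ∈ V2 ∧ ¬ G.Adj v1 v := by intro v; simp [hX]
  set N := V1.filter (fun y => ∃ x ∈ X, G.Adj y x) with hN
  have memN : ∀ v, v ∈ N ↔ v ∈ V1 ∧ ∃ x ∈ X, G.Adj v x := by intro v; simp [hN]
  have hf1 : f1 ∈ V2 := h12 _ _ ha1.symm hv1
  have hv1X : v1 ∉ X := fun h => hdisj _ hv1 ((memX _).1 h).1
  have hv1N : v1 ∉ N := by
    intro h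
    obtain ⟨_, x, hx, hax⟩ := (memN _).1 h
    exact ((memX _).1 hx).2 hax
  have h2N : ∀ v ∈ V2, v ∉ N := fun v hv h => hdisj v ((memN v).1 h).1 hv
  -- first count
  have hNX : N.card = X.card := by
    let φ : V → V := fun v => if v ∈ X then v else v1
    have key : ∀ a b, a ∈ V1 → b ∈ V2 → a ∉ N → G.Adj a b → φ a = φ b := by
      intro a b ha hb haN hab
      have h1 : a ∉ X := fun h => hdisj _ ha ((memX _).1 h).1
      have h2 : b ∉ X := fun h => haN ((memN _).2 ⟨ha, b, h, hab⟩)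
      simp [φ, h1, h2]
    have hφ : ∀ a b, a ∉ N → b ∉ N → G.Adj a b → φ a = φ b := by
      intro a b ha hb hab
      rcases hbip a b hab with ⟨h1, h2⟩ | ⟨h1, h2⟩
      · exact key a b h1 h2 ha hab
      · exact (key b a h2 h1 hb hab.symm).symm
    have hcut : IsCutSet G N := by
      refine aux_cutset G N φ hφ ?_
      intro s hs
      obtain ⟨hs1, x, hx, hsx⟩ := (memN s).1 hs
      have hd : G.degree s ≠ 1 := by
        intro hd
        have := hu1 s hs1 hd
        subst this
        have := aux_leaf G s _ _ hsx ha2 hd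
        subst this
        exact ((memX _).1 hx).2 hadj
      obtain ⟨y, hy, hne⟩ := aux_other G s x hsx hd
      refine ⟨x, y, h2N _ (h12 _ _ hsx hs1), h2N _ (h12 _ _ hy hs1), hsx, hy, ?_⟩
      simp only [φ, hx, if_true]
      split_ifs
      · exact hne.symm
      · intro h; exact hv1X (h ▸ hx)
    have h1 := hunmixed N hcut
    have hle : (insert v1 X).card ≤ numComp G N := by
      refine aux_lower G N _ φ hφ ?_ ?_
      · intro r hr
        rcases Finset.mem_insert.1 hr with h | h
        · rw [h]; exact hv1N
        · exact h2N _ ((memX _).1 h).1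
      · have : ∀ a ∈ insert v1 X, φ a = a := by
          intro a ha
          rcases Finset.mem_insert.1 ha with h | h
          · rw [h]; simp [φ]
          · simp [φ, h]
        intro a ha b hb h
        rwa [this a ha, this b hb] at h
    have hge : numComp G N ≤ (insert v1 X).card := by
      refine aux_upper G N _ ?_
      have h2case : ∀ v, ∀ hv : v ∈ V2, v ∉ X → 
          (G.induce ((↑N : Set V)ᶜ)).Adj ⟨v1, by simpa using hv1N⟩
            ⟨v, by simpa using h2N v hv⟩ := by
        intro v hv hvX
        by_contra h
        exact hvX ((memX v).2 ⟨hv, h⟩)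
      intro v hv
      by_cases hvX : v ∈ X
      · exact ⟨v, Finset.mem_insert_of_mem hvX, hv, Reachable.refl _⟩
      refine ⟨v1, Finset.mem_insert_self _ _, hv1N, ?_⟩
      rcases hcover v with h | h
      · obtain ⟨u, hu⟩ := hnb v
        have hu2 := h12 _ _ hu h
        have huX : u ∉ X := fun hh => hv ((memN _).2 ⟨h, u, hh, hu⟩)
        refine (h2case u hu2 huX).reachable.trans (Adj.reachable ?_)
        exact hu.symm
      · exact (h2case v h hvX).reachable
    rw [Finset.card_insert_of_notMem hv1X] at hle hge
    omega
  -- second count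
  set S := (G.neighborFinset v1).erase f1 with hS
  have memS : ∀ v, v ∈ S ↔ v ≠ f1 ∧ G.Adj v1 v := by intro v; simp [hS]
  have hSV2 : ∀ v ∈ S, v ∈ V2 := fun v hv => h12 _ _ ((memS v).1 hv).2 hv1
  have h1S : ∀ v ∈ V1, v ∉ S := fun v hv h => hdisj v hv (hSV2 v h)
  have hx0X : x0 ∈ X := (memX _).2 ⟨hx0, hx0a⟩
  have hf1v1 : f1 ≠ v1 := fun h => hdisj _ hv1 (h ▸ hf1)
  let φ : V → V := fun v => if v = f1 then v1 else if v ∈ V1 ∧ v ∉ N then v else f1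
  have hφ1 : ∀ a ∈ V1, a ∉ N → φ a = a := by
    intro a ha haN
    have : a ≠ f1 := fun h => hdisj a ha (h ▸ hf1)
    simp [φ, this, ha, haN]
  have key : ∀ a b, a ∈ V1 → b ∈ V2 → b ∉ S → G.Adj a b → φ a = φ b := by
    intro a b ha hb hbS hab
    by_cases hbf : b = f1
    · subst hbf
      have := aux_leaf G b _ _ hab.symm ha1 hl1
      subst this
      rw [hφ1 a hv1 hv1N]
      simp [φ]
    · have hbX : b ∈ X := (memX _).2 ⟨hb, fun h => hbS ((memS _).2 ⟨hbf, h⟩)⟩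
      have haN : a ∈ N := (memN _).2 ⟨ha, b, hbX, hab⟩
      have haf : a ≠ f1 := fun h => hdisj a ha (h ▸ hf1)
      have hb1 : b ∉ V1 := fun h => hdisj b h hb
      simp [φ, hbf, haf, haN, hb1]
  have hφ : ∀ a b, a ∉ S → b ∉ S → G.Adj a b → φ a = φ b := by
    intro a b ha hb hab
    rcases hbip a b hab with ⟨h1, h2⟩ | ⟨h1, h2⟩
    · exact key a b h1 h2 hb hab
    · exact (key b a h2 h1 ha hab.symm).symm
  have hcut : IsCutSet G S := by
    refine aux_cutset G S φ hφ ?_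
    intro s hs
    obtain ⟨hsf, hsa⟩ := (memS s).1 hs
    have hs2 := hSV2 s hs
    obtain ⟨t, ht, hne⟩ := aux_other G s v1 hsa.symm (fun h => hsf (hu2 s hs2 h))
    have ht1 := h21 _ _ ht hs2
    refine ⟨v1, t, h1S _ hv1, h1S _ ht1, hsa.symm, ht, ?_⟩
    rw [hφ1 v1 hv1 hv1N]
    by_cases htN : t ∈ N
    · have htf : t ≠ f1 := fun h => hdisj t ht1 (h ▸ hf1)
      simp only [φ, htf, htN, if_false, not_true, and_false]
      exact hf1v1.symm
    · rw [hφ1 t ht1 htN]; exact hne.symm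
  have h1 := hunmixed S hcut
  have hx01 : x0 ∉ V1 := fun h => hdisj _ h hx0
  have hx0f : x0 ≠ f1 := fun h => hx0a (h ▸ ha1.symm)
  have hφx0 : φ x0 = f1 := by simp [φ, hx0f, hx01]
  have hf11 : f1 ∉ V1 := fun h => hdisj _ h hf1
  have hle : (insert x0 (V1 \ N)).card ≤ numComp G S := by
    refine aux_lower G S _ φ hφ ?_ ?_
    · intro r hr
      rcases Finset.mem_insert.1 hr with h | h
      · rw [h]; exact fun h => hx0a ((memS _).1 h).2
      · exact h1S _ (Finset.mem_sdiff.1 h).1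
    · intro a ha b hb h
      rcases Finset.mem_insert.1 ha with ha | ha <;> rcases Finset.mem_insert.1 hb with hb | hb
      · rw [ha, hb]
      · have hb := Finset.mem_sdiff.1 hb
        rw [ha, hφx0, hφ1 b hb.1 hb.2] at h
        exact absurd (h ▸ hb.1) hf11
      · have ha := Finset.mem_sdiff.1 ha
        rw [hb, hφx0, hφ1 a ha.1 ha.2] at h
        exact absurd (h ▸ ha.1) hf11
      · have ha := Finset.mem_sdiff.1 ha
        have hb := Finset.mem_sdiff.1 hb
        rwa [hφ1 a ha.1 ha.2, hφ1 b hb.1 hb.2] at h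
  have hNV : N ⊆ V1 := Finset.filter_subset _ _
  have hx0n : x0 ∉ V1 \ N := fun h => hx01 (Finset.mem_sdiff.1 h).1
  rw [Finset.card_insert_of_notMem hx0n, Finset.card_sdiff_of_subset hNV] at hle
  have hNle := Finset.card_le_card hNV
  have hSX : S.card + 1 + X.card = V2.card := by
    have hmem : f1 ∈ G.neighborFinset v1 := by simpa using ha1.symm
    rw [hS, Finset.card_erase_add_one hmem]
    have : G.neighborFinset v1 = V2.filter (fun x => G.Adj v1 x) := by
      ext x
      simp only [mem_neighborFinset, Finset.mem_filter]
      exact ⟨fun h => ⟨h12 _ _ h hv1, h⟩, fun h => h.2⟩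
    rw [this, hX]
    exact Finset.card_filter_add_card_filter_not _
  omega

lemma aux_main {V : Type*} [Fintype V] [DecidableEq V] (G : SimpleGraph V)
    [DecidableRel G.Adj] (hconn : G.Connected) (V1 V2 : Finset V)
    (hdisj : ∀ v, v ∈ V1 → v ∉ V2) (hcover : ∀ v, v ∈ V1 ∨ v ∈ V2)
    (hbip : ∀ a b, G.Adj a b → (a ∈ V1 ∧ b ∈ V2) ∨ (a ∈ V2 ∧ b ∈ V1))
    (hunmixed : Unmixed G)
    (f1 f2 v1 v2 : V) (hl1 : G.degree f1 = 1) (hl2 : G.degree f2 = 1)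
    (ha1 : G.Adj f1 v1) (ha2 : G.Adj f2 v2) (hadj : G.Adj v1 v2) (hv1 : v1 ∈ V1) :
    V1.card = V2.card ∧ G.degree v1 = V1.card ∧ G.degree v2 = V1.card ∧
      ∀ w : V, IsCutSet G {w} → w = v1 ∨ w = v2 := by
  classical
  have hdisj' : ∀ v, v ∈ V2 → v ∉ V1 := fun v h h' => hdisj v h' h
  have hcover' : ∀ v, v ∈ V2 ∨ v ∈ V1 := fun v => (hcover v).symm
  have hbip' : ∀ a b, G.Adj a b → (a ∈ V2 ∧ b ∈ V1) ∨ (a ∈ V1 ∧ b ∈ V2) :=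
    fun a b h => (hbip a b h).symm
  have hnb : ∀ v, ∃ u, G.Adj v u := by
    intro v
    have : Nontrivial V := ⟨f1, v1, ha1.ne⟩
    exact hconn.preconnected.exists_adj_of_nontrivial v
  have h12 : ∀ a b, G.Adj a b → a ∈ V1 → b ∈ V2 := by
    intro a b hab ha
    rcases hbip a b hab with h | h
    · exact h.2
    · exact absurd h.1 (hdisj a ha)
  have h21 : ∀ a b, G.Adj a b → a ∈ V2 → b ∈ V1 := by
    intro a b hab ha
    rcases hbip a b hab with h | h
    · exact absurd ha (hdisj a h.1)
    · exact h.2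
  have hv2 : v2 ∈ V2 := h12 _ _ hadj hv1
  have hf1 : f1 ∈ V2 := h12 _ _ ha1.symm hv1
  have hf2 : f2 ∈ V1 := h21 _ _ ha2.symm hv2
  have s1 := aux_side G V1 V2 hdisj hcover hbip hnb hunmixed
  have s2 := aux_side G V2 V1 hdisj' hcover' hbip' hnb hunmixed
  have c1 := Finset.card_filter_add_card_filter_not (s := V1) (fun v => G.degree v = 1)
  have c2 := Finset.card_filter_add_card_filter_not (s := V2) (fun v => G.degree v = 1)
  have p1 : 0 < (V1.filter (fun v => G.degree v = 1)).card :=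
    Finset.card_pos.2 ⟨f2, Finset.mem_filter.2 ⟨hf2, hl2⟩⟩
  have p2 : 0 < (V2.filter (fun v => G.degree v = 1)).card :=
    Finset.card_pos.2 ⟨f1, Finset.mem_filter.2 ⟨hf1, hl1⟩⟩
  simp only [ne_eq] at s1 s2
  have hcard : V1.card = V2.card := by omega
  have q1 : (V1.filter (fun v => G.degree v = 1)).card ≤ 1 := by omega
  have q2 : (V2.filter (fun v => G.degree v = 1)).card ≤ 1 := by omega
  have hu1 : ∀ v ∈ V1, G.degree v = 1 → v = f2 := fun v hv hd =>
    Finset.card_le_one.1 q1 v (Finset.mem_filter.2 ⟨hv, hd⟩) f2 (Finset.mem_filter.2 ⟨hf2, hl2⟩)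
  have hu2 : ∀ v ∈ V2, G.degree v = 1 → v = f1 := fun v hv hd =>
    Finset.card_le_one.1 q2 v (Finset.mem_filter.2 ⟨hv, hd⟩) f1 (Finset.mem_filter.2 ⟨hf1, hl1⟩)
  have a1 := aux_half G V1 V2 hdisj hcover hbip hnb hunmixed hcard f1 f2 v1 v2 hl1 hl2 ha1 ha2
    hadj hv1 hu1 hu2
  have a2 := aux_half G V2 V1 hdisj' hcover' hbip' hnb hunmixed hcard.symm f2 f1 v2 v1 hl2 hl1
    ha2 ha1 hadj.symm hv2 hu2 hu1
  have n1 : G.neighborFinset v1 = V2 := by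
    ext x
    simp only [mem_neighborFinset]
    exact ⟨fun h => h12 _ _ h hv1, a1 x⟩
  have n2 : G.neighborFinset v2 = V1 := by
    ext x
    simp only [mem_neighborFinset]
    exact ⟨fun h => h21 _ _ h hv2, a2 x⟩
  refine ⟨hcard, ?_, ?_, ?_⟩
  · rw [← G.card_neighborFinset_eq_degree, n1, hcard]
  · rw [← G.card_neighborFinset_eq_degree, n2]
  intro w hw
  by_contra! hne
  have hc := hunmixed _ hw
  rw [Finset.card_singleton] at hc
  have hle : numComp G {w} ≤ ({v1} : Finset V).card := by
    refine aux_upper G {w} {v1} ?_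
    intro v hv
    have h1w : v1 ∉ ({w} : Finset V) := by simpa using hne.1.symm
    have h2w : v2 ∉ ({w} : Finset V) := by simpa using hne.2.symm
    refine ⟨v1, by simp, h1w, ?_⟩
    rcases hcover v with h | h
    · have e1 : (G.induce ((↑({w} : Finset V) : Set V)ᶜ)).Adj
          ⟨v1, by simpa using h1w⟩ ⟨v2, by simpa using h2w⟩ := hadj
      refine e1.reachable.trans (Adj.reachable ?_)
      exact a2 v h
    · refine Adj.reachable ?_
      exact a1 v h
  rw [Finset.card_singleton] at hle
  omega

theorem stmt5 {V : Type*} [Fintype V] [DecidableEq V] (G : SimpleGraph V)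
    [DecidableRel G.Adj] (hconn : G.Connected) (hcard : 4 ≤ Fintype.card V)
    (V1 V2 : Finset V) (hdisj : Disjoint V1 V2) (hcover : V1 ∪ V2 = Finset.univ)
    (hne1 : V1.Nonempty) (hne2 : V2.Nonempty)
    (hbip : ∀ a b, G.Adj a b → (a ∈ V1 ∧ b ∈ V2) ∨ (a ∈ V2 ∧ b ∈ V1))
    (hunmixed : Unmixed G)
    (f1 f2 v1 v2 : V) (hf : f1 ≠ f2) (hl1 : G.degree f1 = 1) (hl2 : G.degree f2 = 1)
    (ha1 : G.Adj f1 v1) (ha2 : G.Adj f2 v2)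
    (hadj : G.Adj v1 v2) :
    V1.card = V2.card ∧ G.degree v1 = V1.card ∧ G.degree v2 = V1.card ∧
      ∀ w : V, IsCutSet G {w} → w = v1 ∨ w = v2 := by
  have hd : ∀ v, v ∈ V1 → v ∉ V2 := fun v h h' => Finset.disjoint_left.1 hdisj h h'
  have hc : ∀ v, v ∈ V1 ∨ v ∈ V2 := by
    intro v
    rw [← Finset.mem_union, hcover]
    exact Finset.mem_univ v
  rcases hc v1 with h | h
  · exact aux_main G hconn V1 V2 hd hc hbip hunmixed f1 f2 v1 v2 hl1 hl2 ha1 ha2 hadj h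
  · obtain ⟨h1, h2, h3, h4⟩ := aux_main G hconn V2 V1 (fun v h h' => hd v h' h)
      (fun v => (hc v).symm) (fun a b h => (hbip a b h).symm) hunmixed f1 f2 v1 v2 hl1 hl2
      ha1 ha2 hadj h
    exact ⟨h1.symm, h2.trans h1, h3.trans h1, h4⟩
end

section
/- Let H be a bipartite graph with bipartition V_1 ⊔ V_2, |V_1| = |V_2|, satisfying the unmixedness condition (c_H(S) = |S| + 1 for all cut sets S of H), and suppose the neighbours of the two leaves of H are adjacent. Let G be obtained from H by adding two new vertices v and f and all edges {v,x} for x ∈ V_1 ∪ {f}. Then G satisfies the unmixedness condition, and the cut sets of G are exactly: ∅, V_1, the sets S ∪ {v} for S a cut set of H, and the cut sets T of H with T ⊆ V_1. -/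
open SimpleGraph Finset

/-- The graph obtained from `H` by adding a new vertex `v = Sum.inr true` joined to all of
`V1` and to a new leaf `f = Sum.inr false`. -/
def coneGraph {V : Type*} (H : SimpleGraph V) (V1 : Finset V) : SimpleGraph (V ⊕ Bool) :=
  SimpleGraph.fromRel (fun x y =>
    match x, y with
    | Sum.inl a, Sum.inl b => H.Adj a b
    | Sum.inr true, Sum.inl a => a ∈ V1
    | Sum.inr true, Sum.inr false => True
    | _, _ => False)

namespace CG

variable {V : Type*}

/-- Number of connected components of the induced subgraph on `P`. -/
noncomputable def cc (G : SimpleGraph V) (P : Set V) : ℕ :=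
  Nat.card (G.induce P).ConnectedComponent

/-- `C` is a union of connected components of the induced subgraph on `P`. -/
def Cl (G : SimpleGraph V) (P C : Set V) : Prop :=
  C ⊆ P ∧ ∀ x ∈ C, ∀ y ∈ P, G.Adj x y → y ∈ C

def Conn (G : SimpleGraph V) (P : Set V) : Prop :=
  P.Nonempty ∧ ∀ C, Cl G P C → C.Nonempty → C = P

def comp (G : SimpleGraph V) (P : Set V) (a : V) : Set V :=
  {b | b ∈ P ∧ ∀ C, Cl G P C → a ∈ C → b ∈ C}

/-- Cut sets through separation. -/
def Cut (G : SimpleGraph V) (T : Set V) : Prop :=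
  ∀ t ∈ T, ∃ a b, G.Adj t a ∧ G.Adj t b ∧ a ∉ T ∧ b ∉ T ∧ ∃ C, Cl G Tᶜ C ∧ a ∈ C ∧ b ∉ C

theorem cc_union [Finite V] (G : SimpleGraph V) {P Q : Set V} (hd : Disjoint P Q)
    (hn : ∀ x ∈ P, ∀ y ∈ Q, ¬ G.Adj x y) : cc G (P ∪ Q) = cc G P + cc G Q := by
  classical
  unfold cc
  rw [← Nat.card_sum]
  symm
  let fP : G.induce P →g G.induce (P ∪ Q) := ⟨fun x => ⟨x.1, Or.inl x.2⟩, fun h => h⟩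
  let fQ : G.induce Q →g G.induce (P ∪ Q) := ⟨fun x => ⟨x.1, Or.inr x.2⟩, fun h => h⟩
  let F : (G.induce P).ConnectedComponent ⊕ (G.induce Q).ConnectedComponent →
    (G.induce (P ∪ Q)).ConnectedComponent := Sum.elim (·.map fP) (·.map fQ)
  let g : ↥(P ∪ Q) → (G.induce P).ConnectedComponent ⊕ (G.induce Q).ConnectedComponent :=
    fun x => if h : x.1 ∈ P then Sum.inl ((G.induce P).connectedComponentMk ⟨x.1, h⟩)
      else Sum.inr ((G.induce Q).connectedComponentMk ⟨x.1, x.2.resolve_left h⟩)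
  have hg : ∀ x y, (G.induce (P ∪ Q)).Adj x y → g x = g y := by
    intro x y hxy
    have hxy' : G.Adj x.1 y.1 := hxy
    by_cases hx : x.1 ∈ P <;> by_cases hy : y.1 ∈ P
    · simp only [g, hx, hy, dif_pos]
      congr 1
      apply SimpleGraph.ConnectedComponent.sound
      exact SimpleGraph.Adj.reachable (by exact hxy')
    · exact absurd hxy' (hn _ hx _ (y.2.resolve_left hy))
    · exact absurd hxy'.symm (hn _ hy _ (x.2.resolve_left hx))
    · simp only [g, hx, hy, dif_neg, not_false_iff]
      congr 1
      apply SimpleGraph.ConnectedComponent.sound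
      exact SimpleGraph.Adj.reachable (by exact hxy')
  have hg' : ∀ x y, ∀ p : (G.induce (P ∪ Q)).Walk x y, g x = g y := by
    intro x y p
    induction p with
    | nil => rfl
    | cons h _ ih => exact (hg _ _ h).trans ih
  let L : (G.induce (P ∪ Q)).ConnectedComponent →
    (G.induce P).ConnectedComponent ⊕ (G.induce Q).ConnectedComponent :=
    SimpleGraph.ConnectedComponent.lift g (fun x y p _ => hg' x y p)
  refine Nat.card_congr ⟨F, L, ?_, ?_⟩
  · rintro (c | c)
    · induction c using SimpleGraph.ConnectedComponent.ind with
      | _ x =>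
        show g ⟨x.1, Or.inl x.2⟩ = _
        simp [g]
    · induction c using SimpleGraph.ConnectedComponent.ind with
      | _ x =>
        show g ⟨x.1, Or.inr x.2⟩ = _
        have : x.1 ∉ P := fun h => Set.disjoint_left.1 hd h x.2
        simp [g, this]
  · intro c
    induction c using SimpleGraph.ConnectedComponent.ind with
    | _ x =>
      show F (g x) = _
      by_cases hx : x.1 ∈ P
      · simp only [g, hx, dif_pos]; rfl
      · simp only [g, hx, dif_neg, not_false_iff]; rfl

theorem cc_pos [Finite V] (G : SimpleGraph V) {P : Set V} (h : P.Nonempty) : 1 ≤ cc G P := by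
  obtain ⟨x, hx⟩ := h
  have : Nonempty (G.induce P).ConnectedComponent := ⟨(G.induce P).connectedComponentMk ⟨x, hx⟩⟩
  exact Nat.card_pos

theorem cc_conn [Finite V] (G : SimpleGraph V) {P : Set V} (h : Conn G P) : cc G P = 1 := by
  apply le_antisymm _ (cc_pos G h.1)
  unfold cc
  rw [Finite.card_le_one_iff_subsingleton]
  constructor
  intro c d
  induction c using SimpleGraph.ConnectedComponent.ind with
  | _ x =>
  induction d using SimpleGraph.ConnectedComponent.ind with
  | _ y =>
  apply SimpleGraph.ConnectedComponent.sound
  have := h.2 {z | ∃ hz : z ∈ P, (G.induce P).Reachable x ⟨z, hz⟩} ?_ ⟨x.1, x.2, SimpleGraph.Reachable.refl _⟩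
  · obtain ⟨_, hr⟩ := this.ge y.2
    exact hr
  · refine ⟨fun z hz => hz.1, ?_⟩
    rintro z ⟨hz, hr⟩ w hw hzw
    exact ⟨hw, hr.trans (SimpleGraph.Adj.reachable (by exact hzw))⟩

theorem cc_empty [Finite V] (G : SimpleGraph V) : cc G ∅ = 0 := by
  have := cc_union G (P := ∅) (Q := ∅) (by simp) (by simp)
  simp at this
  exact this

theorem Cl.diff {G : SimpleGraph V} {P C : Set V} (h : Cl G P C) : Cl G P (P \ C) :=
  ⟨Set.sdiff_subset, fun x hx y hy hxy => ⟨hy, fun hc => hx.2 (h.2 y hc x hx.1 hxy.symm)⟩⟩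

theorem cc_cl [Finite V] {G : SimpleGraph V} {P C : Set V} (h : Cl G P C) :
    cc G P = cc G C + cc G (P \ C) := by
  rw [← cc_union G Set.disjoint_sdiff_right, Set.union_sdiff_cancel h.1]
  exact fun x hx y hy hxy => hy.2 (h.2 x hx y hy.1 hxy)

theorem conn_of_cc [Finite V] {G : SimpleGraph V} {P : Set V} (h : cc G P = 1) : Conn G P := by
  constructor
  · by_contra hne
    rw [Set.not_nonempty_iff_eq_empty] at hne
    rw [hne, cc_empty] at h
    omega
  · intro C hC hn
    by_contra hne
    have h1 := cc_cl hC
    have h2 := cc_pos G hn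
    have h3 : (P \ C).Nonempty := by
      rw [Set.sdiff_nonempty]
      exact fun hs => hne (Set.Subset.antisymm hC.1 hs)
    have h4 := cc_pos G h3
    omega

theorem conn_singleton (G : SimpleGraph V) (x : V) : Conn G {x} :=
  ⟨⟨x, rfl⟩, fun _ hC hn => (Set.subset_singleton_iff_eq.1 hC.1).resolve_left hn.ne_empty⟩

theorem cc_indep [Finite V] {G : SimpleGraph V} {P : Set V}
    (h : ∀ x ∈ P, ∀ y ∈ P, ¬ G.Adj x y) : cc G P = P.ncard := by
  induction P, P.toFinite using Set.Finite.induction_on with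
  | empty => simp [cc_empty]
  | @insert a s ha hs ih =>
    rw [Set.ncard_insert_of_notMem ha, Set.insert_eq, cc_union, cc_conn G (conn_singleton G a), ih, add_comm]
    · exact fun x hx y hy => h x (Or.inr hx) y (Or.inr hy)
    · simpa using ha
    · rintro x rfl y hy
      exact h x (Or.inl rfl) y (Or.inr hy)

theorem comp_mem {G : SimpleGraph V} {P : Set V} {a : V} (h : a ∈ P) : a ∈ comp G P a :=
  ⟨h, fun _ _ h => h⟩

theorem comp_cl (G : SimpleGraph V) (P : Set V) (a : V) : Cl G P (comp G P a) :=
  ⟨fun _ h => h.1, fun x hx y hy hxy => ⟨hy, fun C hC ha => hC.2 x (hx.2 C hC ha) y hy hxy⟩⟩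

theorem comp_sub {G : SimpleGraph V} {P C : Set V} {a : V} (h : Cl G P C) (ha : a ∈ C) :
    comp G P a ⊆ C := fun _ hx => hx.2 C h ha

theorem Cl.trans {G : SimpleGraph V} {P C D : Set V} (h : Cl G P C) (h' : Cl G C D) : Cl G P D :=
  ⟨h'.1.trans h.1, fun x hx y hy hxy => h'.2 x hx y (h.2 x (h'.1 hx) y hy hxy) hxy⟩

theorem Cl.restrict {G : SimpleGraph V} {P Q C : Set V} (h : Cl G P C) (hQ : Q ⊆ P) :
    Cl G Q (C ∩ Q) :=
  ⟨Set.inter_subset_right, fun x hx y hy hxy => ⟨h.2 x hx.1 y (hQ hy) hxy, hy⟩⟩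

theorem comp_conn {G : SimpleGraph V} {P : Set V} {a : V} (h : a ∈ P) : Conn G (comp G P a) := by
  refine ⟨⟨a, comp_mem h⟩, fun C hC hn => ?_⟩
  have hC' := (comp_cl G P a).trans hC
  by_cases ha : a ∈ C
  · exact Set.Subset.antisymm hC.1 (comp_sub hC' ha)
  · obtain ⟨x, hx⟩ := hn
    exact absurd hx (comp_sub hC'.diff ⟨h, ha⟩ (hC.1 hx)).2

/-- A connected set inside `P` is on one side of each closed set. -/
theorem Conn.side {G : SimpleGraph V} {P C D : Set V} (hD : Conn G D) (hDP : D ⊆ P)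
    (hC : Cl G P C) {x y : V} (hx : x ∈ D) (hy : y ∈ D) (hxC : x ∈ C) : y ∈ C := by
  have := hD.2 _ (hC.restrict hDP) ⟨x, hxC, hx⟩
  rw [← this] at hy
  exact hy.1

theorem Conn.union {G : SimpleGraph V} {P Q : Set V} (hP : Conn G P) (hQ : Conn G Q)
    {x y : V} (hx : x ∈ P) (hy : y ∈ Q) (hxy : G.Adj x y) : Conn G (P ∪ Q) := by
  refine ⟨⟨x, Or.inl hx⟩, fun C hC hn => ?_⟩
  have key : x ∈ C ∧ y ∈ C := by
    obtain ⟨z, hz⟩ := hn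
    rcases hC.1 hz with h | h
    · have hxC := hP.side Set.subset_union_left hC h hx hz
      exact ⟨hxC, hC.2 x hxC y (Or.inr hy) hxy⟩
    · have hyC := hQ.side Set.subset_union_right hC h hy hz
      exact ⟨hC.2 y hyC x (Or.inl hx) hxy.symm, hyC⟩
  apply Set.Subset.antisymm hC.1
  rintro z (h | h)
  · exact hP.side Set.subset_union_left hC hx h key.1
  · exact hQ.side Set.subset_union_right hC hy h key.2

theorem cc_pendant [Finite V] {G : SimpleGraph V} {P : Set V} {x y : V} (hx : x ∉ P) (hy : y ∈ P)
    (hxy : G.Adj x y) (h1 : ∀ z ∈ P, G.Adj x z → z ∈ comp G P y) :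
    cc G (insert x P) = cc G P := by
  have hc := comp_cl G P y
  have hC : Cl G (insert x P) ({x} ∪ comp G P y) := by
    refine ⟨?_, ?_⟩
    · rintro z (rfl | h)
      · exact Or.inl rfl
      · exact Or.inr h.1
    · rintro z (rfl | hz) w (rfl | hw) hzw
      · exact Or.inl rfl
      · exact Or.inr (h1 w hw hzw)
      · exact Or.inl rfl
      · exact Or.inr (hc.2 z hz w hw hzw)
  have hcon := (conn_singleton G x).union (comp_conn (G := G) hy) rfl (comp_mem hy) hxy
  rw [cc_cl hC, cc_cl hc, cc_conn G hcon, cc_conn G (comp_conn hy)]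
  congr 2
  ext z
  simp only [Set.mem_sdiff, Set.mem_insert_iff, Set.mem_union, Set.mem_singleton_iff]
  constructor
  · rintro ⟨h, h'⟩
    exact ⟨h.resolve_left fun h => h' (Or.inl h), fun h => h' (Or.inr h)⟩
  · rintro ⟨h, h'⟩
    exact ⟨Or.inr h, fun hh => hh.elim (fun e => hx (e ▸ h)) h'⟩

theorem cc_insert_lt [Finite V] {G : SimpleGraph V} {P : Set V} {i : V} (hi : i ∉ P) :
    cc G (insert i P) < cc G P ↔
      ∃ a b, G.Adj i a ∧ G.Adj i b ∧ a ∈ P ∧ b ∈ P ∧ ∃ C, Cl G P C ∧ a ∈ C ∧ b ∉ C := by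
  constructor
  · intro hlt
    by_contra hno
    push Not at hno
    by_cases hex : ∃ a ∈ P, G.Adj i a
    · obtain ⟨a, ha, hia⟩ := hex
      have := cc_pendant hi ha hia
        (fun z hz hiz => hno a z hia hiz ha hz _ (comp_cl G P a) (comp_mem ha))
      omega
    · push Not at hex
      rw [Set.insert_eq, cc_union] at hlt
      · omega
      · simpa using hi
      · rintro x rfl y hy
        exact hex y hy
  · rintro ⟨a, b, hia, hib, ha, hb, C, hC, haC, hbC⟩
    have hiP : i ∈ insert i P := Or.inl rfl
    set D := comp G (insert i P) i with hDdef
    have hD := comp_cl G (insert i P) i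
    have hiD : i ∈ D := comp_mem hiP
    have haD : a ∈ D := hD.2 i hiD a (Or.inr ha) hia
    have hbD : b ∈ D := hD.2 i hiD b (Or.inr hb) hib
    have e1 := cc_cl hD
    rw [cc_conn G (comp_conn hiP)] at e1
    have hD' : Cl G P (D ∩ P) := hD.restrict (Set.subset_insert i P)
    have e2 := cc_cl hD'
    have hDC : Cl G (D ∩ P) (C ∩ (D ∩ P)) := hC.restrict Set.inter_subset_right
    have e3 := cc_cl hDC
    have p1 := cc_pos G (P := C ∩ (D ∩ P)) ⟨a, haC, haD, ha⟩
    have p2 := cc_pos G (P := (D ∩ P) \ (C ∩ (D ∩ P))) ⟨b, ⟨hbD, hb⟩, fun h => hbC h.1⟩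
    have e4 : insert i P \ D = P \ (D ∩ P) := by
      ext z
      simp only [Set.mem_sdiff, Set.mem_insert_iff, Set.mem_inter_iff]
      constructor
      · rintro ⟨rfl | h, h'⟩
        · exact absurd hiD h'
        · exact ⟨h, fun hh => h' hh.1⟩
      · rintro ⟨h, h'⟩
        exact ⟨Or.inr h, fun hh => h' ⟨hh, h⟩⟩
    rw [← hDdef, e4] at e1
    omega

theorem isCutSet_iff [Fintype V] [DecidableEq V] (G : SimpleGraph V) (S : Finset V) :
    IsCutSet G S ↔ Cut G (↑S : Set V) := by
  have key : (∀ i ∈ S, numComp G (S.erase i) < numComp G S) ↔ Cut G (↑S : Set V) := by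
    unfold Cut
    simp only [Finset.mem_coe]
    refine forall₂_congr fun i hi => ?_
    have h1 : numComp G (S.erase i) = cc G (insert i (↑S : Set V)ᶜ) := by
      unfold numComp cc
      have : ((↑(S.erase i) : Set V)ᶜ) = insert i (↑S : Set V)ᶜ := by
        ext z
        simp
        tauto
      rw [this]
    rw [h1]
    exact cc_insert_lt (by simpa using hi)
  unfold IsCutSet
  constructor
  · rintro (h | h)
    · subst h
      intro t ht
      simp at ht
    · exact key.1 h.2
  · intro h
    by_cases hS : S = ∅
    · exact Or.inl hS
    · exact Or.inr ⟨hS, key.2 h⟩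

end CG

namespace CG

structure Bip {V : Type*} (H : SimpleGraph V) (X : Set V) (f1 w1 f2 w2 : V) : Prop where
  bip : ∀ a b, H.Adj a b → (a ∈ X ↔ b ∉ X)
  um : ∀ T, Cut H T → cc H Tᶜ = T.ncard + 1
  f1X : f1 ∈ X
  f2X : f2 ∉ X
  a1 : H.Adj f1 w1
  a2 : H.Adj f2 w2
  a12 : H.Adj w1 w2
  u1 : ∀ z, H.Adj f1 z → z = w1
  u2 : ∀ z, H.Adj f2 z → z = w2
  n1 : ∀ x ∈ X, x ≠ f1 → ∀ y, H.Adj x y → ∃ y', y' ≠ y ∧ H.Adj x y'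
  n2 : ∀ x ∉ X, x ≠ f2 → ∀ y, H.Adj x y → ∃ y', y' ≠ y ∧ H.Adj x y'

section
variable {V : Type*} {H : SimpleGraph V} {X : Set V} {f1 w1 f2 w2 : V}

theorem Bip.flip (h : Bip H X f1 w1 f2 w2) : Bip H Xᶜ f2 w2 f1 w1 where
  bip a b hab := by
    have := h.bip a b hab
    simp only [Set.mem_compl_iff]
    tauto
  um := h.um
  f1X := h.f2X
  f2X := fun hh => hh h.f1X
  a1 := h.a2
  a2 := h.a1
  a12 := h.a12.symm
  u1 := h.u2
  u2 := h.u1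
  n1 := h.n2
  n2 x hx := h.n1 x (not_not.1 hx)

theorem Bip.conn [Finite V] (h : Bip H X f1 w1 f2 w2) : Conn H Set.univ := by
  apply conn_of_cc
  have := h.um ∅ (fun t ht => absurd ht (Set.notMem_empty t))
  simpa using this

theorem Bip.nbr [Finite V] (h : Bip H X f1 w1 f2 w2) (x : V) : ∃ y, H.Adj x y := by
  by_contra hno
  push Not at hno
  have := h.conn.2 {x} ⟨Set.subset_univ _, by
    rintro z rfl y _ hzy
    exact absurd hzy (hno y)⟩ ⟨x, rfl⟩
  have h1 : f1 ∈ ({x} : Set V) := this ▸ Set.mem_univ f1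
  have h2 : f2 ∈ ({x} : Set V) := this ▸ Set.mem_univ f2
  have e : f1 = f2 := (show f1 = x from h1).trans (show f2 = x from h2).symm
  exact h.f2X (e ▸ h.f1X)

theorem Cut.two {G : SimpleGraph V} {T : Set V} (h : Cut G T) {t : V} (ht : t ∈ T) {w : V}
    (hu : ∀ z, G.Adj t z → z = w) : False := by
  obtain ⟨a, b, ha, hb, _, _, C, _, haC, hbC⟩ := h t ht
  rw [hu a ha] at haC
  rw [hu b hb] at hbC
  exact hbC haC

theorem Bip.f1T (h : Bip H X f1 w1 f2 w2) {T : Set V} (hT : Cut H T) : f1 ∉ T :=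
  fun hf => hT.two hf h.u1

theorem Bip.indepX (h : Bip H X f1 w1 f2 w2) {P : Set V} (hP : P ⊆ X) :
    ∀ x ∈ P, ∀ y ∈ P, ¬ H.Adj x y := by
  intro x hx y hy hxy
  exact (h.bip x y hxy).1 (hP hx) (hP hy)

theorem Bip.nbrA (h : Bip H X f1 w1 f2 w2) {C : Set V} (hC : Conn H C)
    (hA : (C ∩ X).Nonempty) {u : V} (hu : u ∈ C) (huX : u ∉ X) : ∃ a ∈ C ∩ X, H.Adj u a := by
  by_contra hno
  push Not at hno
  have := hC.2 {u} ⟨by simpa using hu, by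
    rintro z rfl y hy hzy
    exact absurd hzy (hno y ⟨hy, by have := h.bip z y hzy; tauto⟩)⟩ ⟨u, rfl⟩
  obtain ⟨a, ha, haX⟩ := hA
  rw [← this] at ha
  rw [show a = u from ha] at haX
  exact huX haX

theorem Bip.A1 [Finite V] (h : Bip H X f1 w1 f2 w2) {T C : Set V} (hTX : T ⊆ X) (hT : Cut H T)
    (hC : Cl H Tᶜ C) (hcon : Conn H C) (hf : f1 ∉ C) :
    (C \ X).ncard = (C ∩ X).ncard + 1 := by
  have hcut : Cut H (T ∪ (C ∩ X)) := by
    rintro t (ht | ⟨htC, htX⟩)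
    · obtain ⟨a, b, hta, htb, ha, hb, D, hD, haD, hbD⟩ := hT t ht
      have haX := (h.bip t a hta).1 (hTX ht)
      have hbX := (h.bip t b htb).1 (hTX ht)
      have ha' : a ∉ T ∪ (C ∩ X) := fun hh => hh.elim ha (fun h => haX h.2)
      refine ⟨a, b, hta, htb, ha', fun hh => hh.elim hb (fun h => hbX h.2),
        D ∩ (T ∪ (C ∩ X))ᶜ, hD.restrict ?_, ⟨haD, ha'⟩, fun hh => hbD hh.1⟩
      exact Set.compl_subset_compl.2 Set.subset_union_left
    · obtain ⟨y, hy⟩ := h.nbr t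
      obtain ⟨y', hne, hy'⟩ := h.n1 t htX (fun e => hf (e ▸ htC)) y hy
      have hyX := (h.bip _ _ hy).1 htX
      have hyX' := (h.bip _ _ hy').1 htX
      have hyT : y ∉ T ∪ (C ∩ X) := fun hh => hh.elim (fun h => hyX (hTX h)) (fun h => hyX h.2)
      have hyC : y ∈ C := hC.2 t htC y (fun hh => hyX (hTX hh)) hy
      refine ⟨y, y', hy, hy', hyT,
        fun hh => hh.elim (fun h => hyX' (hTX h)) (fun h => hyX' h.2), {y}, ⟨?_, ?_⟩, rfl, hne⟩
      · rintro z rfl; exact hyT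
      · rintro z rfl w hw hzw
        exfalso
        have hwX : w ∈ X := by have := h.bip z w hzw; tauto
        have hwT : w ∉ T := fun hh => hw (Or.inl hh)
        exact hw (Or.inr ⟨hC.2 z hyC w hwT hzw, hwX⟩)
  have e1 := h.um _ hcut
  have e2 := h.um _ hT
  rw [cc_cl hC, cc_conn H hcon] at e2
  have hset : (T ∪ (C ∩ X))ᶜ = (Tᶜ \ C) ∪ (C \ X) := by
    ext z
    have := @hC.1 z
    simp only [Set.mem_compl_iff, Set.mem_union, Set.mem_inter_iff, Set.mem_sdiff] at this ⊢
    tauto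
  rw [hset, cc_union, cc_indep (P := C \ X), Set.ncard_union_eq] at e1
  · omega
  · exact Set.disjoint_left.2 fun z hz hz' => hC.1 hz'.1 hz
  · exact h.flip.indepX (fun z hz => hz.2)
  · exact Set.disjoint_left.2 fun z hz hz' => hz.2 hz'.1
  · intro x hx y hy hxy
    exact hx.2 (hC.2 y hy.1 x hx.1 hxy.symm)

theorem Bip.A3 [Finite V] (h : Bip H X f1 w1 f2 w2) {T C : Set V} (hTX : T ⊆ X) (hT : Cut H T)
    (hC : Cl H Tᶜ C) (hcon : Conn H C) (hf : f1 ∉ C) (hf2 : f2 ∉ C) (hA : (C ∩ X).Nonempty) :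
    Cut H (C \ X) ∧ cc H Cᶜ = 2 := by
  have hAU : ∀ a ∈ C ∩ X, ∀ z, H.Adj a z → z ∈ C \ X := by
    intro a ha z haz
    have hzX := (h.bip a z haz).1 ha.2
    exact ⟨hC.2 a ha.1 z (fun hh => hzX (hTX hh)) haz, hzX⟩
  have hcut : Cut H (C \ X) := by
    rintro u ⟨huC, huX⟩
    obtain ⟨a, ha, hua⟩ := h.nbrA hcon hA huC huX
    obtain ⟨a', hne, hua'⟩ := h.n2 u huX (fun e => hf2 (e ▸ huC)) a hua
    have ha'X : a' ∈ X := by have := h.bip u a' hua'; tauto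
    refine ⟨a, a', hua, hua', fun hh => hh.2 ha.2, fun hh => hh.2 ha'X, {a}, ⟨?_, ?_⟩, rfl, hne⟩
    · rintro z rfl; exact fun hh => hh.2 ha.2
    · rintro z rfl w hw hzw
      exact absurd (hAU z ha w hzw) hw
  refine ⟨hcut, ?_⟩
  have e1 := h.um _ hcut
  have e2 := h.A1 hTX hT hC hcon hf
  have hset : (C \ X)ᶜ = (C ∩ X) ∪ Cᶜ := by
    ext z
    simp only [Set.mem_compl_iff, Set.mem_union, Set.mem_inter_iff, Set.mem_sdiff]
    tauto
  rw [hset, cc_union, cc_indep (P := C ∩ X)] at e1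
  · omega
  · exact h.indepX (fun z hz => hz.2)
  · exact Set.disjoint_left.2 fun z hz hz' => hz' hz.1
  · intro x hx y hy hxy
    exact hy (hAU x hx y hxy).1

theorem Bip.A [Finite V] (h : Bip H X f1 w1 f2 w2) {T C : Set V} (hTX : T ⊆ X) (hT : Cut H T)
    (hC : Cl H Tᶜ C) (hcon : Conn H C) (hA : (C ∩ X).Nonempty) : f1 ∈ C := by
  by_contra hf
  have hf1T := h.f1T hT
  have hw1X : w1 ∉ X := (h.bip _ _ h.a1).1 h.f1X
  have hw1C : w1 ∉ C := fun hh => hf (hC.2 w1 hh f1 hf1T h.a1.symm)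
  have hw2C : w2 ∉ C := fun hh => hw1C (hC.2 w2 hh w1 (fun hh => hw1X (hTX hh)) h.a12.symm)
  have hf2 : f2 ∉ C := by
    intro hh
    obtain ⟨a, ha, hfa⟩ := h.nbrA hcon hA hh h.f2X
    rw [h.u2 a hfa] at ha
    exact hw2C ha.1
  obtain ⟨hUcut, hcc⟩ := h.A3 hTX hT hC hcon hf hf2 hA
  set D1 := comp H Cᶜ f1 with hD1def
  have hD1 : Cl H Cᶜ D1 := comp_cl H Cᶜ f1
  have hD1c : Conn H D1 := comp_conn hf
  have hf1D : f1 ∈ D1 := comp_mem hf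
  have hw1D : w1 ∈ D1 := hD1.2 f1 hf1D w1 hw1C h.a1
  have hw2D : w2 ∈ D1 := hD1.2 w1 hw1D w2 hw2C h.a12
  have hf2D : f2 ∈ D1 := hD1.2 w2 hw2D f2 hf2 h.a2.symm
  have hccD := cc_cl hD1
  rw [cc_conn H hD1c, hcc] at hccD
  set D2 := Cᶜ \ D1 with hD2def
  have hD2c : Conn H D2 := conn_of_cc (by omega)
  have hD2 : Cl H Cᶜ D2 := hD1.diff
  have hD2U : Cl H (C \ X)ᶜ D2 := by
    refine ⟨fun z hz hz' => hz.1 hz'.1, ?_⟩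
    intro x hx y hy hxy
    by_cases hyC : y ∈ C
    · exfalso
      have hyX : y ∈ X := by by_contra hh; exact hy ⟨hyC, hh⟩
      have hxX := (h.bip y x hxy.symm).1 hyX
      exact hx.1 (hC.2 y hyC x (fun hh => hxX (hTX hh)) hxy.symm)
    · exact hD2.2 x hx y hyC hxy
  have hB : (D2 ∩ Xᶜ).Nonempty := by
    obtain ⟨x, hx⟩ := hD2c.1
    by_cases hxX : x ∈ X
    · by_cases hz : ∃ z, H.Adj x z ∧ z ∉ C \ X
      · obtain ⟨z, hxz, hz⟩ := hz
        exact ⟨z, hD2U.2 x hx z hz hxz, (h.bip x z hxz).1 hxX⟩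
      · exfalso
        push Not at hz
        have hxT : x ∈ T := by
          by_contra hxT
          obtain ⟨y, hy⟩ := h.nbr x
          exact hx.1 (hC.2 y (hz y hy).1 x hxT hy.symm)
        obtain ⟨a, b, hta, htb, ha, hb, D, hD, haD, hbD⟩ := hT x hxT
        exact hbD (hcon.side hC.1 hD (hz a hta).1 (hz b htb).1 haD)
    · exact ⟨x, hx, hxX⟩
  have h3 := (h.flip.A3 (T := C \ X) (C := D2) (fun z hz => hz.2) hUcut hD2U hD2c
    (fun hh => hh.2 hf2D) (fun hh => hh.2 hf1D) hB).2
  have hset : D2ᶜ = D1 ∪ C := by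
    ext z
    have := @hD1.1 z
    simp only [hD2def, Set.mem_compl_iff, Set.mem_union, Set.mem_sdiff] at this ⊢
    tauto
  have hadj : ∃ x ∈ D1, ∃ y ∈ C, H.Adj x y := by
    by_contra hno
    push Not at hno
    have := h.conn.2 D1 ⟨Set.subset_univ _, fun x hx y _ hxy =>
      hD1.2 x hx y (fun hy => hno x hx y hy hxy) hxy⟩ ⟨f1, hf1D⟩
    obtain ⟨c, hc⟩ := hcon.1
    have hcD : c ∈ D1 := this ▸ Set.mem_univ c
    exact hD1.1 hcD hc
  obtain ⟨x, hx, y, hy, hxy⟩ := hadj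
  have := cc_conn H (hD1c.union hcon hx hy hxy)
  rw [← hset] at this
  omega

/-- Structure of the cut sets contained in `X`. -/
theorem Bip.struct [Finite V] (h : Bip H X f1 w1 f2 w2) {T : Set V} (hTX : T ⊆ X) (hT : Cut H T) :
    (∀ t ∈ T, ∃ y, H.Adj t y ∧ ∀ z, H.Adj y z → z ∈ T) ∧
    {y | y ∉ X ∧ ∀ z, H.Adj y z → z ∈ T}.ncard = T.ncard := by
  have hf1T : f1 ∈ Tᶜ := h.f1T hT
  set C := comp H Tᶜ f1 with hCdef
  have hC : Cl H Tᶜ C := comp_cl H Tᶜ f1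
  have hCc : Conn H C := comp_conn hf1T
  have hf1C : f1 ∈ C := comp_mem hf1T
  have hX : ∀ x ∈ X, x ∉ T → x ∈ C := by
    intro x hx hxT
    have hf := h.A hTX hT (comp_cl H Tᶜ x) (comp_conn hxT) ⟨x, comp_mem hxT, hx⟩
    exact (comp_conn (G := H) hxT).side (comp_cl H Tᶜ x).1 hC hf (comp_mem hxT) hf1C
  have hI : Tᶜ \ C = {y | y ∉ X ∧ ∀ z, H.Adj y z → z ∈ T} := by
    ext y
    constructor
    · rintro ⟨hyT, hyC⟩
      have hyX : y ∉ X := fun hh => hyC (hX y hh hyT)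
      refine ⟨hyX, fun z hyz => ?_⟩
      by_contra hzT
      have hzX : z ∈ X := by have := h.bip y z hyz; tauto
      exact hyC (hC.2 z (hX z hzX hzT) y hyT hyz.symm)
    · rintro ⟨hyX, hy⟩
      refine ⟨fun hh => hyX (hTX hh), fun hyC => ?_⟩
      have := hCc.2 {y} ⟨by simpa using hyC, by
        rintro z rfl w hw hzw
        exact absurd (hy w hzw) (hC.1 hw)⟩ ⟨y, rfl⟩
      rw [← this] at hf1C
      exact hyX ((show f1 = y from hf1C) ▸ h.f1X)
  constructor
  · intro t ht
    obtain ⟨a, b, hta, htb, ha, hb, D, hD, haD, hbD⟩ := hT t ht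
    by_cases haC : a ∈ C
    · have hbC : b ∉ C := fun hbC => hbD (hCc.side hC.1 hD haC hbC haD)
      have : b ∈ Tᶜ \ C := ⟨hb, hbC⟩
      rw [hI] at this
      exact ⟨b, htb, this.2⟩
    · have : a ∈ Tᶜ \ C := ⟨ha, haC⟩
      rw [hI] at this
      exact ⟨a, hta, this.2⟩
  · have e := h.um _ hT
    rw [cc_cl hC, cc_conn H hCc, hI, cc_indep (h.flip.indepX (fun z hz => hz.1))] at e
    omega

/-- Unions of neighbourhoods are the whole side or cut sets. -/
theorem Bip.conv [Finite V] (h : Bip H X f1 w1 f2 w2) {T : Set V} (hTX : T ⊆ X)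
    (hT : ∀ t ∈ T, ∃ y, H.Adj t y ∧ ∀ z, H.Adj y z → z ∈ T) : T = X ∨ Cut H T := by
  by_cases hf : f1 ∈ T
  · left
    have hw1X : w1 ∉ X := (h.bip _ _ h.a1).1 h.f1X
    have hw : ∀ z, H.Adj w1 z → z ∈ T := by
      obtain ⟨y, hy, hy'⟩ := hT f1 hf
      rw [← h.u1 y hy]; exact hy'
    have hcl : Cl H (T \ {f1})ᶜ {f1, w1} := by
      constructor
      · rintro z (rfl | rfl)
        · exact fun hh => hh.2 rfl
        · exact fun hh => hw1X (hTX hh.1)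
      · rintro z (rfl | rfl) y hy hzy
        · exact Or.inr (h.u1 y hzy)
        · left
          by_contra hne
          exact hy ⟨hw y hzy, hne⟩
    have hcut : Cut H (T \ {f1}) := by
      rintro t ⟨ht, htf⟩
      obtain ⟨y, hty, hy⟩ := hT t ht
      obtain ⟨y', hne, hty'⟩ := h.n1 t (hTX ht) htf y hty
      have hyX := (h.bip _ _ hty).1 (hTX ht)
      have hyX' := (h.bip _ _ hty').1 (hTX ht)
      refine ⟨y, y', hty, hty', fun hh => hyX (hTX hh.1), fun hh => hyX' (hTX hh.1), ?_⟩
      by_cases hyw : y = w1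
      · refine ⟨{f1, w1}, hcl, Or.inr hyw, ?_⟩
        rintro (e | e)
        · exact hyX' (e ▸ h.f1X)
        · exact hne (e.trans hyw.symm)
      · refine ⟨{y}, ⟨?_, ?_⟩, rfl, hne⟩
        · rintro z rfl; exact fun hh => hyX (hTX hh.1)
        · rintro z rfl x hx hzx
          exfalso
          refine hx ⟨hy x hzx, fun e => hyw ?_⟩
          rw [show x = f1 from e] at hzx
          exact h.u1 z hzx.symm
    apply Set.Subset.antisymm hTX
    intro x hx
    by_contra hxT
    have hx' : x ∈ (T \ {f1})ᶜ := fun hh => hxT hh.1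
    have hc := h.A (T := T \ {f1}) (fun z hz => hTX hz.1) hcut (comp_cl H _ x) (comp_conn hx')
      ⟨x, comp_mem hx', hx⟩
    have := (comp_conn (G := H) hx').side (comp_cl H _ x).1 hcl hc (comp_mem hx') (Or.inl rfl)
    rcases this with e | e
    · exact hxT (e ▸ hf)
    · exact hw1X (e ▸ hx)
  · right
    intro t ht
    obtain ⟨y, hty, hy⟩ := hT t ht
    obtain ⟨y', hne, hty'⟩ := h.n1 t (hTX ht) (fun e => hf (e ▸ ht)) y hty
    have hyX := (h.bip _ _ hty).1 (hTX ht)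
    have hyX' := (h.bip _ _ hty').1 (hTX ht)
    refine ⟨y, y', hty, hty', fun hh => hyX (hTX hh), fun hh => hyX' (hTX hh), {y}, ⟨?_, ?_⟩,
      rfl, hne⟩
    · rintro z rfl; exact fun hh => hyX (hTX hh)
    · rintro z rfl x hx hzx
      exact absurd (hy x hzx) hx

/-- Uniqueness of the leaf on one side. -/
theorem leaf_unique [Finite V] (bip : ∀ a b, H.Adj a b → (a ∈ X ↔ b ∉ X))
    (um : ∀ T, Cut H T → cc H Tᶜ = T.ncard + 1) (hcard : X.ncard = Xᶜ.ncard)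
    (hnbr : ∀ x, ∃ y, H.Adj x y) {f w : V} (hfX : f ∈ X) (hu : ∀ z, H.Adj f z → z = w) :
    ∀ x ∈ X, x ≠ f → ∀ y, H.Adj x y → ∃ y', y' ≠ y ∧ H.Adj x y' := by
  set L : Set V := {x | x ∈ X ∧ ∀ y, H.Adj x y → ∃ y', y' ≠ y ∧ H.Adj x y'} with hL
  have hcut : Cut H L := by
    rintro x ⟨hx, hx2⟩
    obtain ⟨y, hxy⟩ := hnbr x
    obtain ⟨y', hne, hxy'⟩ := hx2 y hxy
    have hyX := (bip _ _ hxy).1 hx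
    have hyX' := (bip _ _ hxy').1 hx
    refine ⟨y, y', hxy, hxy', fun hh => hyX hh.1, fun hh => hyX' hh.1,
      {z | z = y ∨ (z ∉ L ∧ z ∈ X ∧ H.Adj z y)}, ⟨?_, ?_⟩, Or.inl rfl, ?_⟩
    · rintro z (rfl | hz)
      · exact fun hh => hyX hh.1
      · exact hz.1
    · rintro z (rfl | ⟨hzL, hzX, hzy⟩) u hu hzu
      · right
        exact ⟨hu, by have := bip z u hzu; tauto, hzu.symm⟩
      · left
        by_contra hne
        apply hzL
        refine ⟨hzX, fun v hv => ?_⟩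
        by_cases hvy : v = y
        · exact ⟨u, fun e => hne (e.trans hvy), hzu⟩
        · exact ⟨y, fun e => hvy e.symm, hzy⟩
    · rintro (e | e)
      · exact hne e
      · exact hyX' e.2.1
  have e := um _ hcut
  have hind : cc H Xᶜ = Xᶜ.ncard := cc_indep (by
    intro x hx y hy hxy
    have := bip x y hxy
    simp only [Set.mem_compl_iff] at hx hy
    tauto)
  have hM : ∀ M : Set V, M ⊆ X \ L → cc H (M ∪ Xᶜ) = Xᶜ.ncard := by
    intro M
    induction M, M.toFinite using Set.Finite.induction_on with
    | empty => intro _; simpa using hind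
    | @insert a s ha hs ih =>
      intro hsub
      have haX := hsub (Set.mem_insert a s)
      obtain ⟨y, hay⟩ := hnbr a
      have hyX := (bip a y hay).1 haX.1
      have hay' : ∀ z, H.Adj a z → z = y := by
        intro z haz
        by_contra hne
        apply haX.2
        refine ⟨haX.1, fun v hv => ?_⟩
        by_cases hvy : v = y
        · exact ⟨z, fun e => hne (e.trans hvy), haz⟩
        · exact ⟨y, fun e => hvy e.symm, hay⟩
      have hy : y ∈ s ∪ Xᶜ := Or.inr hyX
      rw [Set.insert_union, cc_pendant (y := y) _ hy hay]
      · exact ih ((Set.subset_insert a s).trans hsub)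
      · intro z hz haz
        rw [hay' z haz]
        exact comp_mem hy
      · exact fun hh => hh.elim ha (fun h => h haX.1)
  have hset : Lᶜ = (X \ L) ∪ Xᶜ := by
    ext z
    simp only [Set.mem_compl_iff, Set.mem_union, Set.mem_sdiff]
    have : z ∈ L → z ∈ X := fun h => h.1
    tauto
  rw [hset, hM _ subset_rfl] at e
  have hLX : L ⊆ X := fun z hz => hz.1
  have e2 := Set.ncard_sdiff_add_ncard_of_subset hLX
  have e3 : (X \ L).ncard = 1 := by omega
  obtain ⟨q, hq⟩ := Set.ncard_eq_one.1 e3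
  intro x hx hxf
  by_contra hno
  have hxL : x ∈ X \ L := ⟨hx, fun hh => hno hh.2⟩
  have hfL : f ∈ X \ L := by
    refine ⟨hfX, fun hh => ?_⟩
    obtain ⟨y, hy⟩ := hnbr f
    obtain ⟨y', hne, hy'⟩ := hh.2 y hy
    exact hne ((hu _ hy').trans (hu _ hy).symm)
  rw [hq] at hxL hfL
  exact hxf ((show x = q from hxL).trans (show f = q from hfL).symm)

end

end CG

namespace CG

section
variable {V : Type*} {H : SimpleGraph V} {V1 : Finset V}

theorem adj_ll {a b : V} : (coneGraph H V1).Adj (Sum.inl a) (Sum.inl b) ↔ H.Adj a b := by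
  simp only [coneGraph, SimpleGraph.fromRel_adj]
  constructor
  · rintro ⟨_, h | h⟩
    · exact h
    · exact h.symm
  · exact fun h => ⟨fun e => h.ne (Sum.inl_injective e), Or.inl h⟩

theorem adj_vl {a : V} : (coneGraph H V1).Adj (Sum.inr true) (Sum.inl a) ↔ a ∈ V1 := by
  simp [coneGraph, SimpleGraph.fromRel_adj]

theorem adj_lv {a : V} : (coneGraph H V1).Adj (Sum.inl a) (Sum.inr true) ↔ a ∈ V1 := by
  rw [SimpleGraph.adj_comm, adj_vl]

theorem adj_vf : (coneGraph H V1).Adj (Sum.inr true) (Sum.inr false) := by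
  simp [coneGraph, SimpleGraph.fromRel_adj]

theorem adj_lf {a : V} : ¬ (coneGraph H V1).Adj (Sum.inl a) (Sum.inr false) := by
  simp [coneGraph, SimpleGraph.fromRel_adj]

theorem adj_f {z : V ⊕ Bool} (h : (coneGraph H V1).Adj (Sum.inr false) z) : z = Sum.inr true := by
  rcases z with a | (_ | _)
  · exact absurd h.symm adj_lf
  · exact absurd h (SimpleGraph.irrefl _)
  · rfl

theorem cc_inl (P : Set V) : cc (coneGraph H V1) (Sum.inl '' P) = cc H P := by
  unfold cc
  have e : H.induce P ≃g (coneGraph H V1).induce (Sum.inl '' P) :=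
    ⟨Equiv.Set.image Sum.inl P Sum.inl_injective, by
      intro a b
      exact adj_ll (V1 := V1)⟩
  exact (Nat.card_congr e.connectedComponentEquiv).symm

variable {f1 w1 f2 w2 : V}

/-- Cut sets that contain the apex. -/
theorem cut_apex (h : Bip H (↑V1 : Set V) f1 w1 f2 w2) (T : Set V) :
    Cut (coneGraph H V1) (insert (Sum.inr true) (Sum.inl '' T)) ↔ Cut H T := by
  constructor
  · intro hc t ht
    obtain ⟨a, b, hta, htb, ha, hb, C, hC, haC, hbC⟩ := hc (Sum.inl t) (Or.inr ⟨t, ht, rfl⟩)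
    rcases a with a | (_ | _)
    · rcases b with b | (_ | _)
      · refine ⟨a, b, adj_ll.1 hta, adj_ll.1 htb, fun hh => ha (Or.inr ⟨a, hh, rfl⟩),
          fun hh => hb (Or.inr ⟨b, hh, rfl⟩), {x | Sum.inl x ∈ C}, ⟨?_, ?_⟩, haC, hbC⟩
        · exact fun x hx hxT => hC.1 hx (Or.inr ⟨x, hxT, rfl⟩)
        · intro x hx y hy hxy
          refine hC.2 _ hx _ ?_ (adj_ll.2 hxy)
          rintro (e | ⟨z, hz, e⟩)
          · cases e
          · cases e; exact hy hz
      · exact absurd htb adj_lf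
      · exact absurd (Or.inl rfl) hb
    · exact absurd hta adj_lf
    · exact absurd (Or.inl rfl) ha
  · rintro hc _ (rfl | ⟨t, ht, rfl⟩)
    · refine ⟨Sum.inr false, Sum.inl f1, adj_vf, adj_vl.2 h.f1X, ?_, ?_, {Sum.inr false},
        ⟨?_, ?_⟩, rfl, ?_⟩
      · simp
      · simpa using h.f1T hc
      · simp
      · rintro z rfl y hy hzy
        exact absurd (Or.inl (adj_f hzy)) hy
      · simp
    · obtain ⟨a, b, hta, htb, ha, hb, C, hC, haC, hbC⟩ := hc t ht
      refine ⟨Sum.inl a, Sum.inl b, adj_ll.2 hta, adj_ll.2 htb, by simpa using ha,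
        by simpa using hb, Sum.inl '' C, ⟨?_, ?_⟩, ⟨a, haC, rfl⟩, by simpa using hbC⟩
      · rintro _ ⟨x, hx, rfl⟩
        simpa using hC.1 hx
      · rintro _ ⟨x, hx, rfl⟩ y hy hxy
        rcases y with y | (_ | _)
        · exact ⟨y, hC.2 x hx y (fun hh => hy (Or.inr ⟨y, hh, rfl⟩)) (adj_ll.1 hxy), rfl⟩
        · exact absurd hxy adj_lf
        · exact absurd (Or.inl rfl) hy

theorem cc_apex [Finite V] (T : Set V) :
    cc (coneGraph H V1) (insert (Sum.inr true) (Sum.inl '' T))ᶜ = 1 + cc H Tᶜ := by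
  have : (insert (Sum.inr true) (Sum.inl '' T))ᶜ = {(Sum.inr false : V ⊕ Bool)} ∪ Sum.inl '' Tᶜ := by
    ext z
    rcases z with z | (_ | _) <;> simp
  rw [this, cc_union, cc_inl, cc_conn _ (conn_singleton _ _)]
  · simp
  · rintro x rfl _ ⟨y, _, rfl⟩ hxy
    exact adj_lf hxy.symm

theorem cut_base_mp (h : Bip H (↑V1 : Set V) f1 w1 f2 w2) {T : Set V}
    (hc : Cut (coneGraph H V1) (Sum.inl '' T)) :
    T ⊆ ↑V1 ∧ ∀ t ∈ T, ∃ y, H.Adj t y ∧ ∀ z, H.Adj y z → z ∈ T := by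
  have hv : (Sum.inr true : V ⊕ Bool) ∈ (Sum.inl '' T)ᶜ := by simp
  have hsub : T ⊆ ↑V1 := by
    intro t ht
    by_contra htX
    obtain ⟨a, b, hta, htb, ha, hb, C, hC, haC, hbC⟩ := hc (Sum.inl t) ⟨t, ht, rfl⟩
    have key : ∀ a, (coneGraph H V1).Adj (Sum.inl t) a → (coneGraph H V1).Adj a (Sum.inr true) := by
      rintro (a | (_ | _)) hta
      · rw [adj_lv]
        have := h.bip t a (adj_ll.1 hta)
        by_contra hh
        exact htX (this.2 hh)
      · exact absurd hta adj_lf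
      · exact absurd (adj_lv.1 hta) htX
    have hvC := hC.2 a haC _ hv (key a hta)
    exact hbC (hC.2 _ hvC b hb (key b htb).symm)
  refine ⟨hsub, fun t ht => ?_⟩
  obtain ⟨a, b, hta, htb, ha, hb, C, hC, haC, hbC⟩ := hc (Sum.inl t) ⟨t, ht, rfl⟩
  have main : ∀ C, Cl (coneGraph H V1) (Sum.inl '' T)ᶜ C → Sum.inr true ∉ C → ∀ a,
      (coneGraph H V1).Adj (Sum.inl t) a → a ∈ C →
      ∃ y, H.Adj t y ∧ ∀ z, H.Adj y z → z ∈ T := by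
    intro C hC hvC a hta haC
    rcases a with y | (_ | _)
    · refine ⟨y, adj_ll.1 hta, fun z hyz => ?_⟩
      by_contra hzT
      have hzC := hC.2 _ haC (Sum.inl z) (by simpa using hzT) (adj_ll.2 hyz)
      refine hvC (hC.2 _ hzC _ hv (adj_lv.2 ?_))
      have h1 := h.bip t y (adj_ll.1 hta)
      have h2 := h.bip y z hyz
      have h3 := hsub ht
      by_contra hh
      exact h1.1 h3 (h2.2 hh)
    · exact absurd hta adj_lf
    · exact absurd haC hvC
  by_cases hvC : Sum.inr true ∈ C
  · exact main _ hC.diff (fun hh => hh.2 hvC) b htb ⟨hb, hbC⟩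
  · exact main _ hC hvC a hta haC

theorem cut_base_mpr {T : Set V} (hT : T ⊆ ↑V1)
    (hy : ∀ t ∈ T, ∃ y, y ∉ V1 ∧ H.Adj t y ∧ ∀ z, H.Adj y z → z ∈ T) :
    Cut (coneGraph H V1) (Sum.inl '' T) := by
  rintro _ ⟨t, ht, rfl⟩
  obtain ⟨y, hyX, hty, hy⟩ := hy t ht
  refine ⟨Sum.inl y, Sum.inr true, adj_ll.2 hty, adj_lv.2 (hT ht), ?_, by simp, {Sum.inl y},
    ⟨?_, ?_⟩, rfl, by simp⟩
  · simpa using fun hh => hyX (hT hh)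
  · rintro _ rfl
    simpa using fun hh => hyX (hT hh)
  · rintro _ rfl z hz hyz
    exfalso
    rcases z with z | (_ | _)
    · exact hz ⟨z, hy z (adj_ll.1 hyz), rfl⟩
    · exact adj_lf hyz
    · exact hyX (adj_lv.1 hyz)

theorem cc_base [Finite V] (h : Bip H (↑V1 : Set V) f1 w1 f2 w2) {T : Set V} (hT : T ⊆ ↑V1) :
    cc (coneGraph H V1) (Sum.inl '' T)ᶜ =
      {y | y ∉ (↑V1 : Set V) ∧ ∀ z, H.Adj y z → z ∈ T}.ncard + 1 := by
  set I := {y | y ∉ (↑V1 : Set V) ∧ ∀ z, H.Adj y z → z ∈ T} with hI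
  have hcl : Cl (coneGraph H V1) (Sum.inl '' T)ᶜ (Sum.inl '' I) := by
    constructor
    · rintro _ ⟨y, hy, rfl⟩
      simpa using fun hh => hy.1 (hT hh)
    · rintro _ ⟨y, hy, rfl⟩ z hz hyz
      exfalso
      rcases z with z | (_ | _)
      · exact hz ⟨z, hy.2 z (adj_ll.1 hyz), rfl⟩
      · exact adj_lf hyz
      · exact hy.1 (adj_lv.1 hyz)
  rw [cc_cl hcl, cc_inl, cc_indep (h.flip.indepX (fun z hz => hz.1)), cc_conn]
  have hv : (Sum.inr true : V ⊕ Bool) ∈ (Sum.inl '' T)ᶜ \ Sum.inl '' I := by simp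
  refine ⟨⟨_, hv⟩, fun Z hZ hn => ?_⟩
  have key : ∀ Z, Cl (coneGraph H V1) ((Sum.inl '' T)ᶜ \ Sum.inl '' I) Z → Z.Nonempty →
      Sum.inr true ∈ Z := by
    rintro Z hZ ⟨x, hx⟩
    have hxP := hZ.1 hx
    rcases x with x | (_ | _)
    · by_cases hxX : x ∈ V1
      · exact hZ.2 _ hx _ hv (adj_lv.2 hxX)
      · have hxI : x ∉ I := fun hh => hxP.2 ⟨x, hh, rfl⟩
        have : ∃ z, H.Adj x z ∧ z ∉ T := by
          by_contra hno
          push Not at hno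
          exact hxI ⟨hxX, hno⟩
        obtain ⟨z, hxz, hzT⟩ := this
        have hzX : z ∈ V1 := by
          by_contra hh
          exact hxX ((h.bip x z hxz).2 hh)
        have hzP : Sum.inl z ∈ (Sum.inl '' T)ᶜ \ (Sum.inl '' I : Set (V ⊕ Bool)) := by
          refine ⟨by simpa using hzT, ?_⟩
          rintro ⟨z', hz', e⟩
          cases e
          exact hz'.1 hzX
        exact hZ.2 _ (hZ.2 _ hx _ hzP (adj_ll.2 hxz)) _ hv (adj_lv.2 hzX)
    · exact hZ.2 _ hx _ hv adj_vf.symm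
    · exact hx
  by_contra hne
  refine (key _ hZ.diff ?_).2 (key _ hZ hn)
  rw [Set.sdiff_nonempty]
  exact fun hs => hne (Set.Subset.antisymm hZ.1 hs)

/-- Set-level form of the result. -/
theorem cone_main [Finite V] (h : Bip H (↑V1 : Set V) f1 w1 f2 w2)
    (hcard : (↑V1 : Set V).ncard = ((↑V1 : Set V)ᶜ).ncard) (S : Set (V ⊕ Bool)) :
    (Cut (coneGraph H V1) S ↔ (∃ T, S = Sum.inl '' T ∧ (T = ↑V1 ∨ (T ⊆ ↑V1 ∧ Cut H T))) ∨
      ∃ T, S = insert (Sum.inr true) (Sum.inl '' T) ∧ Cut H T) ∧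
    (Cut (coneGraph H V1) S → cc (coneGraph H V1) Sᶜ = S.ncard + 1) := by
  have hiff : Cut (coneGraph H V1) S ↔
      (∃ T, S = Sum.inl '' T ∧ (T = ↑V1 ∨ (T ⊆ ↑V1 ∧ Cut H T))) ∨
      ∃ T, S = insert (Sum.inr true) (Sum.inl '' T) ∧ Cut H T := by
    constructor
    · intro hc
      have hf : Sum.inr false ∉ S := fun hf => hc.two hf (fun z hz => adj_f hz)
      by_cases hv : Sum.inr true ∈ S
      · right
        have : S = insert (Sum.inr true) (Sum.inl '' {x | Sum.inl x ∈ S}) := by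
          ext z
          rcases z with z | (_ | _) <;> simp [hf, hv]
        refine ⟨_, this, ?_⟩
        rw [this] at hc
        exact (cut_apex h _).1 hc
      · left
        have : S = Sum.inl '' {x | Sum.inl x ∈ S} := by
          ext z
          rcases z with z | (_ | _) <;> simp [hf, hv]
        refine ⟨_, this, ?_⟩
        rw [this] at hc
        obtain ⟨h1, h2⟩ := cut_base_mp h hc
        exact (h.conv h1 h2).imp id (fun h3 => ⟨h1, h3⟩)
    · rintro (⟨T, rfl, rfl | ⟨hT, hc⟩⟩ | ⟨T, rfl, hc⟩)
      · apply cut_base_mpr subset_rfl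
        intro t ht
        obtain ⟨y, hy⟩ := h.nbr t
        have hyX := (h.bip t y hy).1 ht
        refine ⟨y, hyX, hy, fun z hz => ?_⟩
        by_contra hh
        exact hyX ((h.bip y z hz).2 hh)
      · apply cut_base_mpr hT
        intro t ht
        obtain ⟨y, hy, hy'⟩ := (h.struct hT hc).1 t ht
        exact ⟨y, (h.bip t y hy).1 (hT ht), hy, hy'⟩
      · exact (cut_apex h T).2 hc
  refine ⟨hiff, fun hc => ?_⟩
  rcases hiff.1 hc with ⟨T, rfl, rfl | ⟨hT, hc⟩⟩ | ⟨T, rfl, hcT⟩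
  · rw [cc_base h subset_rfl, Set.ncard_image_of_injective _ Sum.inl_injective, hcard]
    congr 2
    ext y
    constructor
    · exact fun hy => hy.1
    · intro hy
      refine ⟨hy, fun z hz => ?_⟩
      by_contra hh
      exact hy ((h.bip y z hz).2 hh)
  · rw [cc_base h hT, Set.ncard_image_of_injective _ Sum.inl_injective, (h.struct hT hc).2]
  · rw [cc_apex, h.um T hcT, Set.ncard_insert_of_notMem (by simp),
      Set.ncard_image_of_injective _ Sum.inl_injective]
    omega

end

end CG

theorem stmt6 {V : Type*} [Fintype V] [DecidableEq V] (H : SimpleGraph V)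
    [DecidableRel H.Adj] (hconn : H.Connected)
    (V1 V2 : Finset V) (hdisj : Disjoint V1 V2) (hcover : V1 ∪ V2 = Finset.univ)
    (hne1 : V1.Nonempty) (hne2 : V2.Nonempty)
    (hbip : ∀ a b, H.Adj a b → (a ∈ V1 ∧ b ∈ V2) ∨ (a ∈ V2 ∧ b ∈ V1))
    (hcard : V1.card = V2.card)
    (hunmixedH : Unmixed H)
    -- the neighbours of the two leaves of `H` are adjacent
    (hleaves : ∃ f1 f2 w1 w2 : V, f1 ≠ f2 ∧ H.degree f1 = 1 ∧ H.degree f2 = 1 ∧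
      H.Adj f1 w1 ∧ H.Adj f2 w2 ∧ H.Adj w1 w2) :
    Unmixed (coneGraph H V1) ∧
    ∀ S : Finset (V ⊕ Bool), IsCutSet (coneGraph H V1) S ↔
      (S = ∅ ∨
       S = V1.map ⟨Sum.inl, Sum.inl_injective⟩ ∨
       (∃ T : Finset V, IsCutSet H T ∧
          S = insert (Sum.inr true) (T.map ⟨Sum.inl, Sum.inl_injective⟩)) ∨
       (∃ T : Finset V, IsCutSet H T ∧ T ⊆ V1 ∧
          S = T.map ⟨Sum.inl, Sum.inl_injective⟩)) := by
  
  classical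
  have hcompl : ((↑V1 : Set V)ᶜ) = ↑V2 := by
    ext x
    have hx : x ∈ V1 ∪ V2 := hcover ▸ Finset.mem_univ x
    have hd : x ∈ V1 → x ∉ V2 := fun h1 h2 => Finset.disjoint_left.1 hdisj h1 h2
    simp only [Finset.mem_union] at hx
    simp only [Set.mem_compl_iff, Finset.mem_coe]
    tauto
  have hV2 : ∀ x, x ∈ V2 ↔ x ∉ V1 := by
    intro x
    have : x ∈ ((↑V1 : Set V)ᶜ) ↔ x ∈ (↑V2 : Set V) := by rw [hcompl]
    simpa using this.symm
  have hcard' : (↑V1 : Set V).ncard = ((↑V1 : Set V)ᶜ).ncard := by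
    rw [hcompl, Set.ncard_coe_finset, Set.ncard_coe_finset, hcard]
  have bip : ∀ a b, H.Adj a b → (a ∈ (↑V1 : Set V) ↔ b ∉ (↑V1 : Set V)) := by
    intro a b hab
    have := hbip a b hab
    rw [hV2, hV2] at this
    simp only [Finset.mem_coe]
    tauto
  have um : ∀ T, CG.Cut H T → CG.cc H Tᶜ = T.ncard + 1 := by
    intro T hT
    have e : (↑T.toFinset : Set V) = T := by simp
    have := hunmixedH T.toFinset ((CG.isCutSet_iff H _).2 (by rw [e]; exact hT))
    rw [← Set.ncard_coe_finset, e] at this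
    rw [← this]
    unfold CG.cc numComp
    rw [e]
  have hleaf : ∀ f w, H.degree f = 1 → H.Adj f w → ∀ z, H.Adj f z → z = w := by
    intro f w hd hfw z hfz
    obtain ⟨q, hq⟩ := Finset.card_eq_one.1 hd
    have h1 : z ∈ H.neighborFinset f := by simpa using hfz
    have h2 : w ∈ H.neighborFinset f := by simpa using hfw
    rw [hq, Finset.mem_singleton] at h1 h2
    rw [h1, h2]
  have hnbr : ∀ x, ∃ y, H.Adj x y := by
    intro x
    obtain ⟨a, ha⟩ := hne1
    obtain ⟨b, hb⟩ := hne2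
    have hab : a ≠ b := fun e => (hV2 b).1 hb (e ▸ ha)
    have : Nontrivial V := ⟨a, b, hab⟩
    exact hconn.preconnected.exists_adj_of_nontrivial x
  have hB : ∃ f1 w1 f2 w2, CG.Bip H (↑V1 : Set V) f1 w1 f2 w2 := by
    obtain ⟨f1, f2, w1, w2, hne, d1, d2, a1, a2, a12⟩ := hleaves
    have main : ∀ f1 f2 w1 w2, H.degree f1 = 1 → H.degree f2 = 1 → H.Adj f1 w1 → H.Adj f2 w2 →
        H.Adj w1 w2 → f1 ∈ (↑V1 : Set V) → CG.Bip H (↑V1 : Set V) f1 w1 f2 w2 := by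
      intro f1 f2 w1 w2 d1 d2 a1 a2 a12 hf
      have hf2 : f2 ∉ (↑V1 : Set V) := by
        have b1 := bip _ _ a1
        have b2 := bip _ _ a2
        have b3 := bip _ _ a12
        tauto
      have bip' : ∀ a b, H.Adj a b → (a ∈ ((↑V1 : Set V)ᶜ) ↔ b ∉ ((↑V1 : Set V)ᶜ)) := by
        intro a b hab
        have := bip a b hab
        simp only [Set.mem_compl_iff]
        tauto
      exact ⟨bip, um, hf, hf2, a1, a2, a12, hleaf _ _ d1 a1, hleaf _ _ d2 a2,
        CG.leaf_unique bip um hcard' hnbr hf (hleaf _ _ d1 a1),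
        CG.leaf_unique bip' um (by rw [compl_compl]; exact hcard'.symm) hnbr hf2
          (hleaf _ _ d2 a2)⟩
    by_cases hf : f1 ∈ (↑V1 : Set V)
    · exact ⟨f1, w1, f2, w2, main _ _ _ _ d1 d2 a1 a2 a12 hf⟩
    · refine ⟨f2, w2, f1, w1, main _ _ _ _ d2 d1 a2 a1 a12.symm ?_⟩
      have b1 := bip _ _ a1
      have b2 := bip _ _ a2
      have b3 := bip _ _ a12
      tauto
  obtain ⟨f1, w1, f2, w2, h⟩ := hB
  constructor
  · intro S hS
    have := (CG.cone_main h hcard' (↑S)).2 ((CG.isCutSet_iff _ _).1 hS)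
    rw [Set.ncard_coe_finset] at this
    exact this
  · intro S
    rw [CG.isCutSet_iff, (CG.cone_main h hcard' (↑S)).1]
    constructor
    · rintro (⟨T, hS, hT | ⟨hT, hc⟩⟩ | ⟨T, hS, hc⟩)
      · right; left
        apply Finset.coe_injective
        rw [hS, hT]
        simp
      · right; right; right
        refine ⟨T.toFinset, (CG.isCutSet_iff _ _).2 (by simpa using hc), ?_, ?_⟩
        · intro x hx
          exact hT (by simpa using hx)
        · apply Finset.coe_injective
          rw [hS]
          simp
      · right; right; left
        refine ⟨T.toFinset, (CG.isCutSet_iff _ _).2 (by simpa using hc), ?_⟩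
        apply Finset.coe_injective
        rw [hS]
        simp
    · rintro (rfl | rfl | ⟨T, hc, rfl⟩ | ⟨T, hc, hT, rfl⟩)
      · left
        exact ⟨∅, by simp, Or.inr ⟨by simp, fun t ht => absurd ht (Set.notMem_empty t)⟩⟩
      · left
        exact ⟨↑V1, by simp, Or.inl rfl⟩
      · right
        exact ⟨↑T, by simp, (CG.isCutSet_iff _ _).1 hc⟩
      · left
        exact ⟨↑T, by simp, Or.inr ⟨by simpa using hT, (CG.isCutSet_iff _ _).1 hc⟩⟩
end

section
/- For k ≥ 4, let M_{k,k} be the graph on vertex set [2k] with edge set {{1,2},{2k−1,2k}} ∪ {{2i, 2j−1} : 1 ≤ i ≤ k−1, 2 ≤ j ≤ k}. Then the cut sets of M_{k,k} are exactly ∅, {2}, {2k−1}, {2, 2k−1}, V_1 \ {1}, and V_2 \ {2k}, where V_1 is the set of odd-labelled and V_2 the set of even-labelled vertices; moreover c(S) = |S| + 1 for each of these cut sets. -/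
open SimpleGraph Finset

/-- The graph `M_{k,k}` on vertex set `{1, ..., 2k}` (here `Fin (2*k)` with `0`-indexing:
label `ℓ` is index `ℓ - 1`) with edges `{1,2}`, `{2k-1,2k}` and `{2i, 2j-1}` for
`1 ≤ i ≤ k-1`, `2 ≤ j ≤ k`; in `0`-indexed form: `{0,1}`, `{2k-2, 2k-1}` and
`{2i+1, 2j}` for `i < k-1`, `1 ≤ j < k`. -/
def Mgraph (k : ℕ) : SimpleGraph (Fin (2 * k)) :=
  SimpleGraph.fromRel (fun a b =>
    ((a : ℕ) = 0 ∧ (b : ℕ) = 1) ∨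
    ((a : ℕ) = 2 * k - 2 ∧ (b : ℕ) = 2 * k - 1) ∨
    (∃ i j : ℕ, i < k - 1 ∧ 1 ≤ j ∧ j < k ∧ (a : ℕ) = 2 * i + 1 ∧ (b : ℕ) = 2 * j))

section helpers

set_option linter.unusedSectionVars false

variable {V : Type*} [Fintype V] [DecidableEq V]

lemma nm {S : Finset V} (u : ((↑S : Set V)ᶜ : Set V)) : u.1 ∉ S := fun h => u.2 h

/-- Reachability in the complement of `S`. -/
def RR (G : SimpleGraph V) (S : Finset V) (u v : V) : Prop :=
  ∃ (hu : u ∈ ((↑S : Set V)ᶜ)) (hv : v ∈ ((↑S : Set V)ᶜ)),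
    (G.induce ((↑S : Set V)ᶜ)).Reachable ⟨u, hu⟩ ⟨v, hv⟩

lemma RR.refl {G : SimpleGraph V} {S : Finset V} {u : V} (h : u ∉ S) : RR G S u u :=
  ⟨by simpa using h, by simpa using h, SimpleGraph.Reachable.refl _⟩

lemma RR.symm {G : SimpleGraph V} {S : Finset V} {u v : V} (h : RR G S u v) : RR G S v u := by
  obtain ⟨a, b, c⟩ := h
  exact ⟨b, a, c.symm⟩

lemma RR.trans {G : SimpleGraph V} {S : Finset V} {u v w : V} (h : RR G S u v)
    (hp : RR G S v w) : RR G S u w := by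
  obtain ⟨a, b, c⟩ := h
  obtain ⟨ap, bp, cp⟩ := hp
  exact ⟨a, bp, c.trans cp⟩

lemma RR.adj {G : SimpleGraph V} {S : Finset V} {u v : V} (hu : u ∉ S) (hv : v ∉ S)
    (h : G.Adj u v) : RR G S u v :=
  ⟨by simpa using hu, by simpa using hv, SimpleGraph.Adj.reachable (by simpa using h)⟩

/-- Counting components through a colouring. -/
lemma numComp_eq (G : SimpleGraph V) (S : Finset V) (f : V → ℕ) (T : Finset ℕ)
    (hmap : ∀ u, u ∉ S → f u ∈ T) (hsurj : ∀ t ∈ T, ∃ u, u ∉ S ∧ f u = t)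
    (hadj : ∀ u v, u ∉ S → v ∉ S → G.Adj u v → f u = f v)
    (hreach : ∀ u v, u ∉ S → v ∉ S → f u = f v → RR G S u v) :
    numComp G S = T.card := by
  classical
  have key : ∀ u v : ((↑S : Set V)ᶜ : Set V), (G.induce ((↑S : Set V)ᶜ)).Reachable u v →
      f u = f v := by
    rintro u v ⟨p⟩
    induction p with
    | nil => rfl
    | @cons a b c h p ih =>
      rw [← ih]
      exact hadj _ _ (nm a) (nm b) (by simpa using h)
  let F : (G.induce ((↑S : Set V)ᶜ)).ConnectedComponent → T :=
    SimpleGraph.ConnectedComponent.lift (fun u => ⟨f u, hmap u (nm u)⟩)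
      (fun u v p _ => Subtype.ext (key u v ⟨p⟩))
  have hF : Function.Bijective F := by
    constructor
    · intro c d
      induction c using SimpleGraph.ConnectedComponent.ind with | _ u
      induction d using SimpleGraph.ConnectedComponent.ind with | _ v
      intro h
      have h2 : f u = f v := congrArg Subtype.val h
      obtain ⟨_, _, r⟩ := hreach u v (nm u) (nm v) h2
      exact SimpleGraph.ConnectedComponent.sound r
    · rintro ⟨t, ht⟩
      obtain ⟨u, hu, rfl⟩ := hsurj t ht
      exact ⟨SimpleGraph.connectedComponentMk _ ⟨u, by simpa using hu⟩, rfl⟩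
  unfold numComp
  rw [Nat.card_eq_of_bijective F hF]
  simp

/-- The natural map on components. -/
def incl (G : SimpleGraph V) (S : Finset V) (i : V) :
    G.induce ((↑S : Set V)ᶜ) →g G.induce ((↑(S.erase i) : Set V)ᶜ) where
  toFun u := ⟨u.1, by have := nm u; simp; tauto⟩
  map_rel' := by intro a b h; simpa using h

lemma numComp_le (G : SimpleGraph V) (S : Finset V) (i : V)
    (h : ∀ x y, x ∉ S → y ∉ S → G.Adj i x → G.Adj i y → RR G S x y) :
    numComp G S ≤ numComp G (S.erase i) := by
  classical
  let C := (G.induce ((↑S : Set V)ᶜ)).ConnectedComponent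
  let g : ((↑(S.erase i) : Set V)ᶜ : Set V) → Option C := fun u =>
    if hu : u.1 ∈ S then
      (if hx : ∃ x, x ∉ S ∧ G.Adj i x then
        some (SimpleGraph.connectedComponentMk _ ⟨hx.choose, by simpa using hx.choose_spec.1⟩)
      else none)
    else some (SimpleGraph.connectedComponentMk _ ⟨u.1, by simpa using hu⟩)
  have hi : ∀ u : ((↑(S.erase i) : Set V)ᶜ : Set V), u.1 ∈ S → u.1 = i := by
    intro u hu
    have := u.2
    simp at this
    by_contra hne
    exact hne (this hu)
  have half : ∀ u v : ((↑(S.erase i) : Set V)ᶜ : Set V), u.1 ∈ S → v.1 ∉ S → G.Adj u.1 v.1 →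
      g u = g v := by
    intro u v hu hv huv
    have e := hi u hu
    rw [e] at huv
    have hx : ∃ x, x ∉ S ∧ G.Adj i x := ⟨v.1, hv, huv⟩
    simp only [g, hu, hv, dif_pos hx, dif_pos, dif_neg, not_false_eq_true]
    obtain ⟨_, _, r⟩ := h hx.choose v.1 hx.choose_spec.1 hv hx.choose_spec.2 huv
    exact congrArg some (SimpleGraph.ConnectedComponent.sound r)
  have hadj : ∀ u v : ((↑(S.erase i) : Set V)ᶜ : Set V), G.Adj u.1 v.1 → g u = g v := by
    intro u v huv
    by_cases hu : u.1 ∈ S <;> by_cases hv : v.1 ∈ S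
    · rw [hi u hu, hi v hv] at huv
      exact absurd huv (G.irrefl)
    · exact half u v hu hv huv
    · exact (half v u hv hu huv.symm).symm
    · simp only [g, hu, hv, dif_neg, not_false_eq_true]
      obtain ⟨_, _, r⟩ := RR.adj hu hv huv
      exact congrArg some (SimpleGraph.ConnectedComponent.sound r)
  let L : (G.induce ((↑(S.erase i) : Set V)ᶜ)).ConnectedComponent → Option C :=
    SimpleGraph.ConnectedComponent.lift g (by
      intro u v p _
      clear * - p hadj
      induction p with
      | nil => rfl
      | @cons a b c h p ih => rw [← ih]; exact hadj _ _ (by simpa using h))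
  have hL : ∀ c : C, L (c.map (incl G S i)) = some c := by
    intro c
    induction c using SimpleGraph.ConnectedComponent.ind with | _ u
    have : u.1 ∉ S := nm u
    change g (incl G S i u) = _
    simp [g, incl, this]
  unfold numComp
  apply Nat.card_le_card_of_injective (fun c : C => c.map (incl G S i))
  intro c d hcd
  have := congrArg L hcd
  simp only [hL] at this
  exact Option.some.inj this

lemma numComp_lt (G : SimpleGraph V) (S : Finset V) (i x y : V) 
    (hx : x ∉ S) (hy : y ∉ S) (hix : G.Adj i x) (hiy : G.Adj i y) (h : ¬ RR G S x y) :
    numComp G (S.erase i) < numComp G S := by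
  classical
  have hs : Function.Surjective (fun c : (G.induce ((↑S : Set V)ᶜ)).ConnectedComponent =>
      c.map (incl G S i)) := by
    intro c
    induction c using SimpleGraph.ConnectedComponent.ind with | _ u
    by_cases hu : u.1 ∈ S
    · have e : u.1 = i := by
        have := u.2
        simp at this
        by_contra hne
        exact hne (this hu)
      refine ⟨SimpleGraph.connectedComponentMk _ ⟨x, by simpa using hx⟩, ?_⟩
      apply SimpleGraph.ConnectedComponent.sound
      apply SimpleGraph.Adj.reachable
      simp only [SimpleGraph.comap_adj, incl]
      simpa [e] using hix.symm
    · exact ⟨SimpleGraph.connectedComponentMk _ ⟨u.1, by simpa using hu⟩, rfl⟩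
  unfold numComp
  refine lt_of_le_of_ne (Nat.card_le_card_of_surjective _ hs) ?_
  intro he
  have hb := (Nat.bijective_iff_surjective_and_card _).2 ⟨hs, he.symm⟩
  have hxy : SimpleGraph.connectedComponentMk (G.induce ((↑S : Set V)ᶜ)) ⟨x, by simpa using hx⟩
      = SimpleGraph.connectedComponentMk _ ⟨y, by simpa using hy⟩ := by
    apply hb.1
    apply SimpleGraph.ConnectedComponent.sound
    have hi : i ∈ ((↑(S.erase i) : Set V)ᶜ) := by simp
    refine SimpleGraph.Reachable.trans (v := ⟨i, hi⟩) ?_ ?_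
    · apply SimpleGraph.Adj.reachable
      simpa [incl] using hix.symm
    · apply SimpleGraph.Adj.reachable
      simpa [incl] using hiy
  exact h ⟨_, _, SimpleGraph.ConnectedComponent.exact hxy⟩

lemma RR.color {G : SimpleGraph V} {S : Finset V} (f : V → ℕ)
    (hadj : ∀ u v, u ∉ S → v ∉ S → G.Adj u v → f u = f v) {u v : V} (h : RR G S u v) :
    f u = f v := by
  obtain ⟨hu, hv, ⟨p⟩⟩ := h
  suffices ∀ u v : ((↑S : Set V)ᶜ : Set V), (G.induce ((↑S : Set V)ᶜ)).Walk u v →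
      f u = f v from this _ _ p
  intro u v p
  induction p with
  | nil => rfl
  | @cons a b c h p ih =>
    rw [← ih]
    exact hadj _ _ (nm a) (nm b) (by simpa using h)

end helpers

lemma madj {k : ℕ} (hk : 4 ≤ k) (u v : Fin (2 * k)) : (Mgraph k).Adj u v ↔
    ((u : ℕ) = 0 ∧ (v : ℕ) = 1) ∨ ((u : ℕ) = 1 ∧ (v : ℕ) = 0) ∨
    ((u : ℕ) = 2 * k - 2 ∧ (v : ℕ) = 2 * k - 1) ∨ ((u : ℕ) = 2 * k - 1 ∧ (v : ℕ) = 2 * k - 2) ∨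
    ((u : ℕ) % 2 = 1 ∧ (u : ℕ) ≤ 2 * k - 3 ∧ (v : ℕ) % 2 = 0 ∧ 2 ≤ (v : ℕ)) ∨
    ((v : ℕ) % 2 = 1 ∧ (v : ℕ) ≤ 2 * k - 3 ∧ (u : ℕ) % 2 = 0 ∧ 2 ≤ (u : ℕ)) := by
  have hu := u.2
  have hv := v.2
  simp only [Mgraph, SimpleGraph.fromRel_adj, ne_eq, Fin.ext_iff]
  constructor
  · rintro ⟨_, (h | h | ⟨i, j, h⟩) | (h | h | ⟨i, j, h⟩)⟩ <;> omega
  · rintro (h | h | h | h | h | h)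
    · exact ⟨by omega, Or.inl (Or.inl h)⟩
    · exact ⟨by omega, Or.inr (Or.inl ⟨h.2, h.1⟩)⟩
    · exact ⟨by omega, Or.inl (Or.inr (Or.inl h))⟩
    · exact ⟨by omega, Or.inr (Or.inr (Or.inl ⟨h.2, h.1⟩))⟩
    · exact ⟨by omega, Or.inl (Or.inr (Or.inr ⟨u / 2, v / 2, by omega⟩))⟩
    · exact ⟨by omega, Or.inr (Or.inr (Or.inr ⟨v / 2, u / 2, by omega⟩))⟩

lemma img {n : ℕ} (S : Finset (Fin n)) (T : Finset ℕ) (hT : ∀ t ∈ T, t < n) :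
    S.image Fin.val = T ↔ ∀ v : Fin n, v ∈ S ↔ (v : ℕ) ∈ T := by
  constructor
  · rintro rfl v
    simp [Fin.val_inj]
  · intro h
    ext t
    simp only [Finset.mem_image]
    constructor
    · rintro ⟨v, hv, rfl⟩
      exact (h v).1 hv
    · intro ht
      exact ⟨⟨t, hT t ht⟩, (h _).2 ht, rfl⟩

lemma core {k : ℕ} (hk : 4 ≤ k) (S : Finset (Fin (2 * k))) (a b : Fin (2 * k))
    (ha : a ∉ S) (hb : b ∉ S) (ha1 : (a : ℕ) % 2 = 1) (ha2 : (a : ℕ) ≤ 2 * k - 3)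
    (hb1 : (b : ℕ) % 2 = 0) (hb2 : 2 ≤ (b : ℕ)) (u v : Fin (2 * k)) (hu : u ∉ S) (hv : v ∉ S)
    (hu1 : 1 ≤ (u : ℕ)) (hu2 : (u : ℕ) ≤ 2 * k - 2)
    (hv1 : 1 ≤ (v : ℕ)) (hv2 : (v : ℕ) ≤ 2 * k - 2) : RR (Mgraph k) S u v := by
  have main : ∀ u : Fin (2 * k), u ∉ S → 1 ≤ (u : ℕ) → (u : ℕ) ≤ 2 * k - 2 →
      RR (Mgraph k) S u a := by
    intro u hu h1 h2
    by_cases hp : (u : ℕ) % 2 = 0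
    · exact RR.adj hu ha ((madj hk _ _).2 (by omega))
    · exact (RR.adj hu hb ((madj hk _ _).2 (by omega))).trans
        (RR.adj hb ha ((madj hk _ _).2 (by omega)))
  exact (main u hu hu1 hu2).trans (main v hv hv1 hv2).symm

/-- The case of cut sets contained in `{1, 2k-2}` (0-indexed). -/
lemma small {k : ℕ} (hk : 4 ≤ k) (S : Finset (Fin (2 * k)))
    (hS : ∀ v ∈ S, (v : ℕ) = 1 ∨ (v : ℕ) = 2 * k - 2) :
    numComp (Mgraph k) S = S.card + 1 := by
  classical
  let T : Finset ℕ := insert 2 (S.image Fin.val)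
  let o : Fin (2 * k) := ⟨1, by omega⟩
  let w : Fin (2 * k) := ⟨2 * k - 2, by omega⟩
  let f : Fin (2 * k) → ℕ := fun v =>
    if (v : ℕ) = 0 ∧ o ∈ S then 1 else if (v : ℕ) = 2 * k - 1 ∧ w ∈ S then 2 * k - 2 else 2
  have ho : ∀ v : Fin (2 * k), (v : ℕ) = 1 → v = o := fun v h => Fin.ext h
  have hw : ∀ v : Fin (2 * k), (v : ℕ) = 2 * k - 2 → v = w := fun v h => Fin.ext h
  have hT : T.card = S.card + 1 := by
    rw [Finset.card_insert_of_notMem, Finset.card_image_of_injective _ Fin.val_injective]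
    simp only [Finset.mem_image, not_exists, not_and]
    intro v hv h
    have := hS v hv
    omega
  have n3 : (⟨3, by omega⟩ : Fin (2 * k)) ∉ S := fun h => by have := hS _ h; simp at this; omega
  have n2 : (⟨2, by omega⟩ : Fin (2 * k)) ∉ S := fun h => by have := hS _ h; simp at this; omega
  rw [← hT]
  apply numComp_eq _ _ f
  · intro u hu
    simp only [f, T]
    split_ifs with h1 h2
    · exact Finset.mem_insert_of_mem (Finset.mem_image.2 ⟨o, h1.2, rfl⟩)
    · exact Finset.mem_insert_of_mem (Finset.mem_image.2 ⟨w, h2.2, rfl⟩)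
    · simp
  · intro t ht
    rcases Finset.mem_insert.1 ht with rfl | ht
    · refine ⟨⟨2, by omega⟩, n2, ?_⟩
      simp only [f]
      rw [if_neg (by omega), if_neg (by omega)]
    · obtain ⟨v, hv, rfl⟩ := Finset.mem_image.1 ht
      rcases hS v hv with h | h
      · refine ⟨⟨0, by omega⟩, fun h => ?_, ?_⟩
        · have := hS _ h; simp at this; omega
        · rw [ho v h] at hv
          simp [f, hv, h]
      · refine ⟨⟨2 * k - 1, by omega⟩, fun h => ?_, ?_⟩
        · have := hS _ h; simp at this; omega
        · rw [hw v h] at hv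
          simp only [f, hv, h]
          rw [if_neg (by omega), if_pos (by simp)]
  · intro u v hu hv huv
    rw [madj hk] at huv
    have := ho u
    have := ho v
    have := hw u
    have := hw v
    simp only [f]
    split_ifs <;> grind
  · have main : ∀ u : Fin (2 * k), u ∉ S → f u = 2 → RR (Mgraph k) S u ⟨2, by omega⟩ := by
      intro u hu hfu
      have hul := u.2
      by_cases h0 : (u : ℕ) = 0
      · have hoS : o ∉ S := by
          intro h
          simp [f, h0, h] at hfu
        exact (RR.adj hu hoS ((madj hk _ _).2 (by simp [o]; omega))).trans
          (RR.adj hoS n2 ((madj hk _ _).2 (by simp [o]; omega)))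
      by_cases h1 : (u : ℕ) = 2 * k - 1
      · have hwS : w ∉ S := by
          intro h
          simp only [f, h1, h] at hfu
          rw [if_neg (by omega), if_pos (by simp)] at hfu
          omega
        refine (RR.adj hu hwS ((madj hk _ _).2 (by show _ ∨ _; have : (w : ℕ) = 2 * k - 2 := rfl; omega))).trans ?_
        exact core hk S _ _ n3 n2 (by simp) (by simp; omega) (by simp) (by simp) _ _ hwS n2
          (by have : (w : ℕ) = 2 * k - 2 := rfl; omega) (by have : (w : ℕ) = 2 * k - 2 := rfl; omega) (by simp) (by simp; omega)
      · exact core hk S _ _ n3 n2 (by simp) (by simp; omega) (by simp) (by simp) _ _ hu n2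
          (by omega) (by omega) (by simp) (by simp; omega)
    intro u v hu hv huv
    by_cases h2 : f u = 2
    · exact (main u hu h2).trans (main v hv (huv ▸ h2)).symm
    · have : u = v := by
        apply Fin.ext
        simp only [f] at huv h2
        split_ifs at huv h2 <;> omega
      rw [this]
      exact RR.refl hv

lemma colA {k : ℕ} (hk : 4 ≤ k) (S : Finset (Fin (2 * k)))
    (hS : ∀ v : Fin (2 * k), v ∈ S ↔ ((v : ℕ) % 2 = 1 ∧ (v : ℕ) ≠ 2 * k - 1)) (u v)
    (hu : u ∉ S) (hv : v ∉ S) (h : (Mgraph k).Adj u v) :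
    (if (u : ℕ) % 2 = 0 then (u : ℕ) + 1 else u) = (if (v : ℕ) % 2 = 0 then (v : ℕ) + 1 else v) := by
  rw [madj hk] at h
  rw [hS] at hu hv
  split_ifs <;> omega

lemma colB {k : ℕ} (hk : 4 ≤ k) (S : Finset (Fin (2 * k)))
    (hS : ∀ v : Fin (2 * k), v ∈ S ↔ ((v : ℕ) % 2 = 0 ∧ (v : ℕ) ≠ 0)) (u v)
    (hu : u ∉ S) (hv : v ∉ S) (h : (Mgraph k).Adj u v) :
    (if (u : ℕ) % 2 = 1 then (u : ℕ) - 1 else u) = (if (v : ℕ) % 2 = 1 then (v : ℕ) - 1 else v) := by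
  rw [madj hk] at h
  rw [hS] at hu hv
  have := u.2
  have := v.2
  split_ifs <;> omega

lemma countA {k : ℕ} (hk : 4 ≤ k) (S : Finset (Fin (2 * k)))
    (hS : ∀ v : Fin (2 * k), v ∈ S ↔ ((v : ℕ) % 2 = 1 ∧ (v : ℕ) ≠ 2 * k - 1)) :
    numComp (Mgraph k) S = S.card + 1 := by
  have hT : ((Finset.range (2 * k)).filter (fun t => t % 2 = 1)).card = S.card + 1 := by
    rw [← Finset.card_image_of_injective S Fin.val_injective,
      (img S (((Finset.range (2 * k)).filter (fun t => t % 2 = 1)).erase (2 * k - 1)) (by simp; omega)).2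
      (by intro v; rw [hS]; simp; tauto), Finset.card_erase_add_one]
    simp only [Finset.mem_filter, Finset.mem_range]; omega
  rw [← hT]
  apply numComp_eq _ _ (fun u : Fin (2 * k) => if (u : ℕ) % 2 = 0 then (u : ℕ) + 1 else u)
  · intro u hu
    have := u.2
    simp only [Finset.mem_filter, Finset.mem_range]
    split_ifs <;> omega
  · intro t ht
    simp only [Finset.mem_filter, Finset.mem_range] at ht
    refine ⟨⟨t - 1, by omega⟩, ?_, ?_⟩
    · rw [hS]; simp only; omega
    · simp only; rw [if_pos (by omega)]; omega
  · exact fun u v hu hv h => colA hk S hS u v hu hv h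
  · intro u v hu hv h
    by_cases e : u = v
    · rw [e]; exact RR.refl hv
    · apply RR.adj hu hv
      rw [madj hk]
      rw [hS] at hu hv
      rw [Fin.ext_iff] at e
      split_ifs at h <;> omega

lemma countB {k : ℕ} (hk : 4 ≤ k) (S : Finset (Fin (2 * k)))
    (hS : ∀ v : Fin (2 * k), v ∈ S ↔ ((v : ℕ) % 2 = 0 ∧ (v : ℕ) ≠ 0)) :
    numComp (Mgraph k) S = S.card + 1 := by
  have hT : ((Finset.range (2 * k)).filter (fun t => t % 2 = 0)).card = S.card + 1 := by
    rw [← Finset.card_image_of_injective S Fin.val_injective,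
      (img S (((Finset.range (2 * k)).filter (fun t => t % 2 = 0)).erase 0) (by simp; omega)).2
      (by intro v; rw [hS]; simp; tauto), Finset.card_erase_add_one]
    simp; omega
  rw [← hT]
  apply numComp_eq _ _ (fun u : Fin (2 * k) => if (u : ℕ) % 2 = 1 then (u : ℕ) - 1 else u)
  · intro u hu
    have := u.2
    simp only [Finset.mem_filter, Finset.mem_range]
    split_ifs <;> omega
  · intro t ht
    simp only [Finset.mem_filter, Finset.mem_range] at ht
    refine ⟨⟨t + 1, by omega⟩, ?_, ?_⟩
    · rw [hS]; simp only; omega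
    · simp only; rw [if_pos (by omega)]; omega
  · exact fun u v hu hv h => colB hk S hS u v hu hv h
  · intro u v hu hv h
    by_cases e : u = v
    · rw [e]; exact RR.refl hv
    · apply RR.adj hu hv
      rw [madj hk]
      rw [hS] at hu hv
      rw [Fin.ext_iff] at e
      split_ifs at h <;> omega

/-- The three shapes of a cut set. -/
def Shape (k : ℕ) (S : Finset (Fin (2 * k))) : Prop :=
  (∀ v ∈ S, (v : ℕ) = 1 ∨ (v : ℕ) = 2 * k - 2) ∨
  (∀ v : Fin (2 * k), v ∈ S ↔ ((v : ℕ) % 2 = 0 ∧ (v : ℕ) ≠ 0)) ∨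
  (∀ v : Fin (2 * k), v ∈ S ↔ ((v : ℕ) % 2 = 1 ∧ (v : ℕ) ≠ 2 * k - 1))

lemma cut_shape {k : ℕ} (hk : 4 ≤ k) (S : Finset (Fin (2 * k))) :
    IsCutSet (Mgraph k) S ↔ Shape k S := by
  constructor
  · rintro (rfl | ⟨-, hS⟩)
    · left; simp
    have key : ∀ i ∈ S, ∃ x y, x ∉ S ∧ y ∉ S ∧ (Mgraph k).Adj i x ∧ (Mgraph k).Adj i y ∧
        ¬ RR (Mgraph k) S x y := by
      intro i hi
      by_contra hc
      push Not at hc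
      exact absurd (hS i hi) (not_lt.2 (numComp_le _ _ _ (fun x y a b c d => hc x y a b c d)))
    have key2 : ∀ i ∈ S, ∃ x y, x ∉ S ∧ y ∉ S ∧ (Mgraph k).Adj i x ∧ (Mgraph k).Adj i y ∧
        (x : ℕ) ≠ y := by
      intro i hi
      obtain ⟨x, y, hx, hy, h1, h2, h3⟩ := key i hi
      refine ⟨x, y, hx, hy, h1, h2, fun e => h3 ?_⟩
      rw [Fin.ext e]
      exact RR.refl hy
    have leaf0 : ∀ i ∈ S, (i : ℕ) ≠ 0 ∧ (i : ℕ) ≠ 2 * k - 1 := by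
      intro i hi
      obtain ⟨x, y, hx, hy, h1, h2, h3⟩ := key2 i hi
      rw [madj hk] at h1 h2
      omega
    by_cases hA : ∃ a : Fin (2 * k), a ∉ S ∧ (a : ℕ) % 2 = 1 ∧ (a : ℕ) ≤ 2 * k - 3
    · by_cases hB : ∃ b : Fin (2 * k), b ∉ S ∧ (b : ℕ) % 2 = 0 ∧ 2 ≤ (b : ℕ)
      · left
        obtain ⟨a, ha, ha1, ha2⟩ := hA
        obtain ⟨b, hb, hb1, hb2⟩ := hB
        intro i hi
        by_contra hc
        obtain ⟨x, y, hx, hy, h1, h2, h3⟩ := key i hi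
        have := leaf0 i hi
        rw [madj hk] at h1 h2
        exact h3 (core hk S a b ha hb ha1 ha2 hb1 hb2 x y hx hy (by omega) (by omega)
          (by omega) (by omega))
      · push Not at hB
        right; left
        intro v
        constructor
        · intro hv
          have := leaf0 v hv
          refine ⟨?_, this.1⟩
          by_contra hc
          obtain ⟨x, y, hx, hy, h1, h2, h3⟩ := key2 v hv
          have hxp := hB x hx
          have hyp := hB y hy
          rw [madj hk] at h1 h2
          omega
        · intro hv
          by_contra hc
          have := hB v hc
          omega
    · push Not at hA
      right; right
      intro v
      have hvl := v.2
      constructor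
      · intro hv
        have := leaf0 v hv
        refine ⟨?_, this.2⟩
        by_contra hc
        obtain ⟨x, y, hx, hy, h1, h2, h3⟩ := key2 v hv
        have hxp := hA x hx
        have hyp := hA y hy
        rw [madj hk] at h1 h2
        omega
      · intro hv
        by_contra hc
        have := hA v hc
        omega
  · intro h
    by_cases h0 : S = ∅
    · exact Or.inl h0
    refine Or.inr ⟨h0, fun i hi => ?_⟩
    rcases h with h | h | h
    · rw [small hk S h, small hk (S.erase i) (fun v hv => h v (Finset.mem_of_mem_erase hv))]
      have := Finset.card_erase_lt_of_mem hi
      omega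
    · have hip := (h i).1 hi
      apply numComp_lt (Mgraph k) S i ⟨1, by omega⟩ ⟨3, by omega⟩
      · rw [h]; simp
      · rw [h]; simp
      · rw [madj hk]; have h2 := i.2; clear hi h; grind
      · rw [madj hk]; have h2 := i.2; clear hi h; grind
      · intro hr
        have := RR.color _ (fun u v hu hv e => colB hk S h u v hu hv e) hr
        simp at this
    · have hip := (h i).1 hi
      apply numComp_lt (Mgraph k) S i ⟨2, by omega⟩ ⟨4, by omega⟩
      · rw [h]; simp
      · rw [h]; simp
      · rw [madj hk]; have h2 := i.2; clear hi h; grind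
      · rw [madj hk]; have h2 := i.2; clear hi h; grind
      · intro hr
        have := RR.color _ (fun u v hu hv e => colA hk S h u v hu hv e) hr
        simp at this

theorem stmt8 (k : ℕ) (hk : 4 ≤ k) :
    (∀ S : Finset (Fin (2 * k)), IsCutSet (Mgraph k) S ↔
      (S.image Fin.val = ∅ ∨
       S.image Fin.val = {1} ∨
       S.image Fin.val = {2 * k - 2} ∨
       S.image Fin.val = {1, 2 * k - 2} ∨
       -- V_1 \ {1}: odd labels other than 1, i.e. even 0-indices other than 0
       S.image Fin.val = ((Finset.range (2 * k)).filter (fun t => t % 2 = 0)).erase 0 ∨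
       -- V_2 \ {2k}: even labels other than 2k, i.e. odd 0-indices other than 2k-1
       S.image Fin.val = ((Finset.range (2 * k)).filter (fun t => t % 2 = 1)).erase (2 * k - 1)))
    ∧ ∀ S : Finset (Fin (2 * k)), IsCutSet (Mgraph k) S → numComp (Mgraph k) S = S.card + 1 := by
  refine ⟨fun S => ?_, fun S hS => ?_⟩
  · rw [cut_shape hk, img S _ (by simp), img S _ (by simp; omega), img S _ (by simp; omega),
      img S _ (by simp; omega), img S _ (by simp; omega), img S _ (by simp; omega)]
    have ha : ∀ v : Fin (2 * k), (v : ℕ) = 1 → v = ⟨1, by omega⟩ := fun v h => Fin.ext h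
    have hb : ∀ v : Fin (2 * k), (v : ℕ) = 2 * k - 2 → v = ⟨2 * k - 2, by omega⟩ :=
      fun v h => Fin.ext h
    simp only [Finset.mem_erase, Finset.mem_filter, Finset.mem_range, Finset.mem_insert,
      Finset.mem_singleton, Finset.notMem_empty, iff_false]
    unfold Shape
    constructor
    · rintro (h | h | h)
      · by_cases h1 : (⟨1, by omega⟩ : Fin (2 * k)) ∈ S <;>
          by_cases h2 : (⟨2 * k - 2, by omega⟩ : Fin (2 * k)) ∈ S
        · right; right; right; left
          exact fun v => ⟨h v, fun e => e.elim (fun e => ha v e ▸ h1) (fun e => hb v e ▸ h2)⟩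
        · right; left
          exact fun v => ⟨fun hv => (h v hv).resolve_right (fun e => h2 (hb v e ▸ hv)),
            fun e => ha v e ▸ h1⟩
        · right; right; left
          exact fun v => ⟨fun hv => (h v hv).resolve_left (fun e => h1 (ha v e ▸ hv)),
            fun e => hb v e ▸ h2⟩
        · left
          exact fun v hv => (h v hv).elim (fun e => h1 (ha v e ▸ hv)) (fun e => h2 (hb v e ▸ hv))
      · right; right; right; right; left
        intro v
        rw [h v]
        have := v.2
        tauto
      · right; right; right; right; right
        intro v
        rw [h v]
        have := v.2
        tauto
    · rintro (h | h | h | h | h | h)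
      · exact Or.inl fun v hv => absurd hv (h v)
      · exact Or.inl fun v hv => Or.inl ((h v).1 hv)
      · exact Or.inl fun v hv => Or.inr ((h v).1 hv)
      · exact Or.inl fun v hv => (h v).1 hv
      · refine Or.inr (Or.inl fun v => ?_)
        rw [h v]
        have := v.2
        tauto
      · refine Or.inr (Or.inr fun v => ?_)
        rw [h v]
        have := v.2
        tauto
  · rcases (cut_shape hk S).1 hS with h | h | h
    · exact small hk S h
    · exact countB hk S h
    · exact countA hk S h
end

section
/- Let G be a graph with unmixed binomial edge ideal and let S ⊂ T be cut sets with |T \ S| = 1. Then {P_S, P_T} is an edge of the dual graph of J_G, i.e., ht(P_S + P_T) = ht(P_S) + 1. -/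
open SimpleGraph Finset

open MvPolynomial in
/-- The prime ideal `P_S(G)` in `R = K[x_1, ..., x_n, y_1, ..., y_n]`: it is generated by the
variables `x_i, y_i` for `i ∈ S` together with the `2`-minors `x_i y_j - x_j y_i` for all
pairs `i, j` lying in a common connected component of `G` restricted to the complement of `S`
(these generate the binomial edge ideals of the complete graphs on the components). -/
noncomputable def PSIdeal {n : ℕ} (K : Type*) [Field K] (G : SimpleGraph (Fin n))
    (S : Finset (Fin n)) : Ideal (MvPolynomial (Fin n ⊕ Fin n) K) :=
  Ideal.span
    ((fun i => (X (Sum.inl i) : MvPolynomial (Fin n ⊕ Fin n) K)) '' (↑S : Set (Fin n)) ∪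
     (fun i => (X (Sum.inr i) : MvPolynomial (Fin n ⊕ Fin n) K)) '' (↑S : Set (Fin n)) ∪
     {p | ∃ i j : Fin n,
        (∃ (hi : i ∈ ((↑S : Set (Fin n))ᶜ)) (hj : j ∈ ((↑S : Set (Fin n))ᶜ)),
          (G.induce ((↑S : Set (Fin n))ᶜ)).Reachable ⟨i, hi⟩ ⟨j, hj⟩) ∧
        p = X (Sum.inl i) * X (Sum.inr j) - X (Sum.inl j) * X (Sum.inr i)})

/-- The height of an ideal: the infimum of the heights (in the prime spectrum) of the
prime ideals containing it. -/
noncomputable def heightIdeal {R : Type*} [CommRing R] (I : Ideal R) : ℕ∞ :=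
  ⨅ (p : PrimeSpectrum R) (_ : I ≤ p.asIdeal), Order.height p

section
open Polynomial Algebra

theorem isAlg_surj {R S : Type*} [CommRing R] [Nontrivial R] [CommRing S] [Algebra R S]
    (h : Function.Surjective (algebraMap R S)) : Algebra.IsAlgebraic R S := by
  constructor
  intro y
  obtain ⟨x, rfl⟩ := h y
  exact isAlgebraic_algebraMap x

theorem fiber_height_le_one {D : Type*} [CommRing D] [IsDomain D] [IsNoetherianRing D]
    (P : Ideal D[X]) [P.IsPrime] (h : P.comap C = ⊥) : P.height ≤ 1 := by
  let F := FractionRing D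
  let := Polynomial.algebra D F
  have := Polynomial.isLocalization (nonZeroDivisors D) F
  have disj : Disjoint ((nonZeroDivisors D).map C : Set D[X]) P := by
    refine Set.disjoint_left.mpr fun a ⟨b, hb⟩ ha ↦ ?_
    have : b ∈ P.comap C := by
      rw [Ideal.mem_comap]
      have := hb.2
      rw [← this] at ha
      exact ha
    rw [h, Ideal.mem_bot] at this
    exact nonZeroDivisors.ne_zero hb.1 this
  have eq2 := IsLocalization.height_map_of_disjoint (S := F[X]) (Submonoid.map C (nonZeroDivisors D)) P disj
  rw [← eq2]
  have hp : (P.map (algebraMap D[X] F[X])).IsPrime :=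
    IsLocalization.isPrime_of_isPrime_disjoint (Submonoid.map C (nonZeroDivisors D)) F[X] P ‹_› disj
  have : ((P.map (algebraMap D[X] F[X])).IsPrincipal) := IsPrincipalIdealRing.principal _
  apply Ideal.height_le_one_of_isPrincipal_of_mem_minimalPrimes (P.map (algebraMap D[X] F[X])) _
  rw [Ideal.minimalPrimes_eq_subsingleton hp.isPrimary, hp.radical]
  rfl

def DimF (K A : Type*) [Field K] [CommRing A] [Algebra K A] (m : ℕ) : Prop :=
  ∀ (p : Ideal A), p.IsPrime → ∃ h t : ℕ, p.height = h ∧ Algebra.trdeg K (A ⧸ p) = t ∧ h + t = m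

theorem DimF.equiv {K : Type*} {A B : Type*} [Field K] [CommRing A] [Algebra K A]
   [CommRing B] [Algebra K B] (e : A ≃ₐ[K] B) {m : ℕ} (h : DimF K A m) : DimF K B m := by
  intro p hp
  obtain ⟨a, b, ha, hb, hab⟩ := h (p.comap e) inferInstance
  refine ⟨a, b, ?_, ?_, hab⟩
  · rw [← ha]
    exact (RingEquiv.height_comap e.toRingEquiv p).symm
  · have e' : (A ⧸ p.comap e) ≃ₐ[K] (B ⧸ p) := Ideal.quotientEquivAlg (p.comap e) p e
      (by 
        have := Ideal.map_comap_of_surjective (e : A →+* B) e.surjective p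
        exact this.symm)
    have h1 := e'.lift_trdeg_eq
    rw [hb] at h1
    rw [Cardinal.lift_natCast] at h1
    exact (Cardinal.lift_eq_nat_iff).mp h1.symm

theorem DimF.field {K : Type*} [Field K] : DimF K K 0 := by
  intro p hp
  have : p = ⊥ := (Ideal.eq_bot_or_top p).resolve_right hp.ne_top
  subst this
  refine ⟨0, 0, ?_, ?_, rfl⟩
  · simp
  · rw [Nat.cast_zero, trdeg_eq_zero_iff]
    exact isAlg_surj Ideal.Quotient.mk_surjective

theorem DimF.poly {K : Type*} {A : Type*} [Field K] [CommRing A] [IsNoetherianRing A] [Algebra K A]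
  {m : ℕ} (h : DimF K A m) : DimF K A[X] (m+1) := by
  intro P hP
  set p : Ideal A := P.comap C with hp
  have hpp : p.IsPrime := inferInstance
  have : P.LiesOver p := ⟨rfl⟩
  obtain ⟨a, b, ha, hb, hab⟩ := h p hpp
  have hht := Ideal.height_eq_height_add_of_liesOver_of_hasGoingDown p P
  let : Algebra (A ⧸ p) (A[X] ⧸ P) := Ideal.Quotient.algebraQuotientOfLEComap (le_refl p)
  have : IsScalarTower K (A ⧸ p) (A[X] ⧸ P) := by
    refine IsScalarTower.of_algebraMap_eq fun x => ?_
    rfl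
  have hinj : Function.Injective (algebraMap (A ⧸ p) (A[X] ⧸ P)) := 
    Ideal.quotientMap_injective
  have : FaithfulSMul (A ⧸ p) (A[X] ⧸ P) := (faithfulSMul_iff_algebraMap_injective _ _).2 hinj
  have : FaithfulSMul K (A ⧸ p) := (faithfulSMul_iff_algebraMap_injective _ _).2 
     (algebraMap K (A ⧸ p)).injective
  have htr := trdeg_add_eq K (A ⧸ p) (A := A[X] ⧸ P)
  set x : A[X] ⧸ P := Ideal.Quotient.mk P X with hx
  have haev : ∀ f : A[X], aeval x (f.map (Ideal.Quotient.mk p)) = Ideal.Quotient.mk P f := by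
    intro f
    induction f using Polynomial.induction_on' with
    | add f g hf hg => simp [hf, hg]
    | monomial n a => 
      rw [Polynomial.map_monomial, aeval_monomial, ← C_mul_X_pow_eq_monomial, map_mul, map_pow]
      rfl
  have hmem : ∀ f : A[X], f ∈ p.map C ↔ f.map (Ideal.Quotient.mk p) = 0 := by
    intro f
    rw [Ideal.mem_map_C_iff, Polynomial.ext_iff]
    simp [Ideal.Quotient.eq_zero_iff_mem]
  have hadj : Algebra.adjoin (A ⧸ p) {x} = ⊤ := by
    rw [_root_.eq_top_iff]
    intro y _
    obtain ⟨f, rfl⟩ := Ideal.Quotient.mk_surjective y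
    rw [← haev]
    exact aeval_mem_adjoin_singleton _ _
  have hpC : p.map C ≤ P := Ideal.map_comap_le
  have : (p.map C).IsPrime := Ideal.isPrime_map_C_of_isPrime
  have hpp' : (p.map (algebraMap A A[X])).IsPrime := this
  have key : ∃ a' b' : ℕ, (P.map (Ideal.Quotient.mk <| p.map (algebraMap A A[X]))).height = a' ∧
      Algebra.trdeg (A ⧸ p) (A[X] ⧸ P) = b' ∧ a' + b' = 1 := by
    by_cases hc : P = p.map C
    · refine ⟨0, 1, ?_, ?_, rfl⟩
      · have : P.map (Ideal.Quotient.mk <| p.map (algebraMap A A[X])) = ⊥ := by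
          rw [Ideal.map_eq_bot_iff_le_ker, Ideal.mk_ker]
          exact hc.le
        rw [this]; simp
      · apply le_antisymm
        · have : Algebra.IsAlgebraic (Algebra.adjoin (A ⧸ p) {x}) (A[X] ⧸ P) := by
            exact isAlg_surj fun y => ⟨⟨y, hadj ▸ trivial⟩, rfl⟩
          have := Algebra.IsAlgebraic.trdeg_le_cardinalMk (A ⧸ p) ({x} : Set (A[X] ⧸ P))
          simpa using this
        · rw [Nat.cast_one, Cardinal.one_le_iff_ne_zero, trdeg_ne_zero_iff]
          refine ⟨x, ?_⟩
          rw [transcendental_iff]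
          intro g hg
          obtain ⟨f, rfl⟩ := Polynomial.map_surjective _ Ideal.Quotient.mk_surjective g
          rw [haev, Ideal.Quotient.eq_zero_iff_mem] at hg
          rw [hc] at hg
          exact (hmem f).1 hg
    · refine ⟨1, 0, ?_, ?_, rfl⟩
      · have hker : RingHom.ker (Ideal.Quotient.mk <| p.map (algebraMap A A[X])) ≤ P := by 
          rw [Ideal.mk_ker]; exact hpC
        have hQ : (P.map (Ideal.Quotient.mk <| p.map (algebraMap A A[X]))).IsPrime := 
          Ideal.map_isPrime_of_surjective Ideal.Quotient.mk_surjective hker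
        apply le_antisymm
        · let e : (A[X] ⧸ (p.map (algebraMap A A[X]))) ≃+* (A ⧸ p)[X] :=
            (Ideal.polynomialQuotientEquivQuotientPolynomial p).symm
          rw [← e.height_map]
          have : (Ideal.map e (P.map (Ideal.Quotient.mk <| p.map (algebraMap A A[X])))).IsPrime := 
            Ideal.map_isPrime_of_equiv e
          apply fiber_height_le_one
          rw [eq_bot_iff]
          intro y hy
          obtain ⟨r, rfl⟩ := Ideal.Quotient.mk_surjective y
          rw [Ideal.mem_comap] at hy
          have : C (Ideal.Quotient.mk p r) = e (Ideal.Quotient.mk _ (C r)) := by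
            simp [e]
          rw [this] at hy
          have h2 : Ideal.Quotient.mk (p.map (algebraMap A A[X])) (C r) ∈ P.map (Ideal.Quotient.mk <| p.map (algebraMap A A[X])) := by
            rw [← Ideal.comap_symm, Ideal.mem_comap] at hy
            simpa using hy
          rw [← Ideal.mem_comap, Ideal.comap_map_of_surjective' _ Ideal.Quotient.mk_surjective, 
            sup_eq_left.2 hker] at h2
          rw [Ideal.mem_bot, Ideal.Quotient.eq_zero_iff_mem]
          exact h2
        · rw [Nat.cast_one, Order.one_le_iff_ne_zero, Ne, Ideal.height_eq_zero_iff_eq_bot]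
          rw [Ideal.map_eq_bot_iff_le_ker, Ideal.mk_ker]
          intro h3
          exact hc (le_antisymm h3 hpC)
      · rw [Nat.cast_zero, trdeg_eq_zero_iff]
        obtain ⟨f, hf, hf'⟩ := Set.not_subset.1 (fun h => hc (le_antisymm h hpC))
        have hxa : IsAlgebraic (A ⧸ p) x := by
          refine ⟨f.map (Ideal.Quotient.mk p), fun h0 => hf' ((hmem f).2 h0), ?_⟩
          rw [haev, Ideal.Quotient.eq_zero_iff_mem]
          exact hf
        constructor
        intro y
        obtain ⟨f, rfl⟩ := Ideal.Quotient.mk_surjective y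
        rw [← haev]
        have h5 : Algebra.adjoin (A ⧸ p) {x} ≤ Subalgebra.algebraicClosure (A ⧸ p) (A[X] ⧸ P) :=
          Algebra.adjoin_le (Set.singleton_subset_iff.2 hxa)
        exact h5 (aeval_mem_adjoin_singleton _ _)
  obtain ⟨a', b', ha', hb', hab'⟩ := key
  refine ⟨a + a', b + b', ?_, ?_, by omega⟩
  · rw [hht, ha, ha']; simp
  · rw [← htr, hb, hb']; simp

theorem DimF.mv {K : Type*} [Field K] (m : ℕ) : DimF K (MvPolynomial (Fin m) K) m := by
  induction m with
  | zero => exact DimF.field.equiv (MvPolynomial.isEmptyAlgEquiv K (Fin 0)).symm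
  | succ m ih => exact ih.poly.equiv (MvPolynomial.finSuccEquiv K m).symm

end

theorem isAlg_of_mul_eq {A B : Type*} [CommRing A] [CommRing B] [IsDomain B] [Algebra A B]
    [FaithfulSMul A B] (a b : A) (y : B) (ha : a ≠ 0) (h : algebraMap A B a * y = algebraMap A B b) :
    IsAlgebraic A y := by
  refine ⟨Polynomial.C a * Polynomial.X - Polynomial.C b, ?_, ?_⟩
  · intro h0
    apply ha
    have := congrArg (fun f => Polynomial.coeff f 1) h0
    simpa [Polynomial.coeff_C] using this
  · simp [h]

open MvPolynomial in
theorem DimF.mv2 {K : Type*} [Field K] (n : ℕ) : DimF K (MvPolynomial (Fin n ⊕ Fin n) K) (n + n) :=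
  (DimF.mv (n + n)).equiv (renameEquiv K finSumFinEquiv.symm)

theorem heightIdeal_eq {R : Type*} [CommRing R] (I : Ideal R) (h : ℕ)
    (h1 : ∀ p : Ideal R, p.IsPrime → I ≤ p → (h : ℕ∞) ≤ p.height)
    (h2 : ∃ p : Ideal R, p.IsPrime ∧ I ≤ p ∧ p.height ≤ h) : heightIdeal I = h := by
  apply le_antisymm
  · obtain ⟨p, hp, hIp, hh⟩ := h2
    refine (iInf₂_le (⟨p, hp⟩ : PrimeSpectrum R) hIp).trans ?_
    rw [← PrimeSpectrum.height_eq_orderHeight]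
    exact hh
  · refine le_iInf₂ fun p hIp => ?_
    rw [← PrimeSpectrum.height_eq_orderHeight]
    exact h1 _ p.2 hIp

open MvPolynomial in
/-- the conditions for a prime to contain the ideal attached to `T` and `f`. -/
def Cond {n : ℕ} {K : Type*} [Field K] (T : Finset (Fin n)) {α : Type} (f : {i // i ∉ T} → α)
    (p : Ideal (MvPolynomial (Fin n ⊕ Fin n) K)) : Prop :=
  (∀ i ∈ T, X (Sum.inl i) ∈ p ∧ X (Sum.inr i) ∈ p) ∧
    ∀ i j : {i // i ∉ T}, f i = f j →
      X (Sum.inl i.1) * X (Sum.inr j.1) - X (Sum.inl j.1) * X (Sum.inr i.1) ∈ p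

open MvPolynomial in
theorem trdeg_upper {n : ℕ} {K : Type*} [Field K] (T : Finset (Fin n)) {α : Type} [Finite α]
    (f : {i // i ∉ T} → α)
    (p : Ideal (MvPolynomial (Fin n ⊕ Fin n) K)) [p.IsPrime] (hp : Cond T f p) :
    Algebra.trdeg K (MvPolynomial (Fin n ⊕ Fin n) K ⧸ p) ≤ (Nat.card {i // i ∉ T} + Nat.card α : ℕ) := by
  classical
  set B := MvPolynomial (Fin n ⊕ Fin n) K ⧸ p with hB
  let x : Fin n → B := fun i => Ideal.Quotient.mk p (X (Sum.inl i))
  let y : Fin n → B := fun i => Ideal.Quotient.mk p (X (Sum.inr i))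
  have hT : ∀ i ∈ T, x i = 0 ∧ y i = 0 := fun i hi =>
    ⟨Ideal.Quotient.eq_zero_iff_mem.2 (hp.1 i hi).1, Ideal.Quotient.eq_zero_iff_mem.2 (hp.1 i hi).2⟩
  have hm : ∀ i j : {i // i ∉ T}, f i = f j → x i * y j = x j * y i := by
    intro i j hij
    have := Ideal.Quotient.eq_zero_iff_mem.2 (hp.2 i j hij)
    rw [map_sub, map_mul, map_mul, sub_eq_zero] at this
    exact this
  let H : α → Prop := fun c => ∃ i, f i = c ∧ x i.1 ≠ 0
  let z : {i // i ∉ T} → B := fun i => if H (f i) then x i else y i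
  let w : α → B := fun c => if h : H c then y (h.choose).1 else 0
  let g : {i // i ∉ T} ⊕ α → B := Sum.elim z w
  set A := Algebra.adjoin K (Set.range g) with hA
  have hg : ∀ k, g k ∈ A := fun k => Algebra.subset_adjoin ⟨k, rfl⟩
  have hx : ∀ b : B, b ∈ A → b ∈ Subalgebra.algebraicClosure A B := fun b hb =>
    isAlgebraic_algebraMap (⟨b, hb⟩ : A)
  have hxA : ∀ i, x i ∈ A := by
    intro i
    by_cases hi : i ∈ T
    · rw [(hT i hi).1]; exact A.zero_mem
    · by_cases hc : H (f ⟨i, hi⟩)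
      · have := hg (Sum.inl ⟨i, hi⟩)
        simpa [g, z, hc] using this
      · have : x i = 0 := by
          by_contra h0
          exact hc ⟨⟨i, hi⟩, rfl, h0⟩
        rw [this]; exact A.zero_mem
  have hyA : ∀ i, y i ∈ Subalgebra.algebraicClosure A B := by
    intro i
    by_cases hi : i ∈ T
    · rw [(hT i hi).2]; exact Subalgebra.zero_mem _
    · by_cases hc : H (f ⟨i, hi⟩)
      · have h1 := hg (Sum.inr (f ⟨i, hi⟩))
        have h2 : g (Sum.inr (f ⟨i, hi⟩)) = y (hc.choose).1 := by
          simp only [g, w, Sum.elim_inr, dif_pos hc]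
        rw [h2] at h1
        obtain ⟨e1, e2⟩ := hc.choose_spec
        have h3 := hm _ ⟨i, hi⟩ e1
        refine isAlg_of_mul_eq (⟨x (hc.choose).1, hxA _⟩ : A)
          ((⟨x i, hxA i⟩ : A) * (⟨_, h1⟩ : A)) (y i) ?_ h3
        intro h0
        exact e2 (congrArg Subtype.val h0)
      · apply hx
        have := hg (Sum.inl ⟨i, hi⟩)
        simpa [g, z, hc] using this
  have : Algebra.IsAlgebraic A B := by
    constructor
    intro b
    obtain ⟨q, rfl⟩ := Ideal.Quotient.mk_surjective b
    change _ ∈ Subalgebra.algebraicClosure A B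
    induction q using MvPolynomial.induction_on with
    | C a => exact hx _ (A.algebraMap_mem a)
    | add q r hq hr => rw [map_add]; exact Subalgebra.add_mem _ hq hr
    | mul_X q i hq =>
      rw [map_mul]
      refine Subalgebra.mul_mem _ hq ?_
      rcases i with i | i
      · exact hx _ (hxA i)
      · exact hyA i
  have h1 := Algebra.IsAlgebraic.trdeg_le_cardinalMk K (Set.range g)
  refine h1.trans ?_
  rw [← Nat.cast_card, Nat.cast_le, ← Nat.card_sum]
  exact Finite.card_range_le g

open MvPolynomial Algebra in
theorem trdeg_lower {n : ℕ} {K : Type*} [Field K] (T : Finset (Fin n)) {α : Type} [Finite α]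
    (f : {i // i ∉ T} → α) (hf : Function.Surjective f) :
    ∃ p : Ideal (MvPolynomial (Fin n ⊕ Fin n) K), p.IsPrime ∧ Cond T f p ∧
    Algebra.trdeg K (MvPolynomial (Fin n ⊕ Fin n) K ⧸ p) = (Nat.card {i // i ∉ T} + Nat.card α : ℕ) := by
  classical
  let L := MvPolynomial ({i // i ∉ T} ⊕ α) K
  let φ : MvPolynomial (Fin n ⊕ Fin n) K →ₐ[K] L := aeval (Sum.elim
    (fun i => if h : i ∉ T then X (Sum.inl ⟨i, h⟩) else 0)
    (fun i => if h : i ∉ T then X (Sum.inl ⟨i, h⟩) * X (Sum.inr (f ⟨i, h⟩)) else 0))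
  have hx : ∀ i : {i // i ∉ T}, φ (X (Sum.inl i.1)) = X (Sum.inl i) := by
    intro i; simp [φ, i.2]
  have hy : ∀ i : {i // i ∉ T}, φ (X (Sum.inr i.1)) = X (Sum.inl i) * X (Sum.inr (f i)) := by
    intro i; simp [φ, i.2]
  refine ⟨RingHom.ker φ, RingHom.ker_isPrime _, ⟨?_, ?_⟩, ?_⟩
  · intro i hi
    simp [RingHom.mem_ker, φ, hi]
  · intro i j hij
    rw [RingHom.mem_ker, map_sub, map_mul, map_mul, hx, hx, hy, hy, hij]
    ring
  · let B := MvPolynomial (Fin n ⊕ Fin n) K ⧸ RingHom.ker φ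
    let ψ : B →ₐ[K] L := Ideal.kerLiftAlg φ
    have hψ : Function.Injective ψ := Ideal.kerLiftAlg_injective φ
    let _ : Algebra B L := ψ.toAlgebra
    have : IsScalarTower K B L := IsScalarTower.of_algebraMap_eq fun r => (ψ.commutes r).symm
    have : (RingHom.ker φ).IsPrime := RingHom.ker_isPrime _
    have : FaithfulSMul B L := (faithfulSMul_iff_algebraMap_injective _ _).2 hψ
    have : FaithfulSMul K B := (faithfulSMul_iff_algebraMap_injective _ _).2 (algebraMap K B).injective
    have hxa : ∀ i, X (Sum.inl i) ∈ Subalgebra.algebraicClosure B L := by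
      intro i
      have : (X (Sum.inl i) : L) = algebraMap B L (Ideal.Quotient.mk _ (X (Sum.inl i.1))) := (hx i).symm
      rw [this]
      exact isAlgebraic_algebraMap _
    have hya : ∀ c, X (Sum.inr c) ∈ Subalgebra.algebraicClosure B L := by
      intro c
      obtain ⟨i, rfl⟩ := hf c
      refine isAlg_of_mul_eq (Ideal.Quotient.mk _ (X (Sum.inl i.1)) : B)
        (Ideal.Quotient.mk _ (X (Sum.inr i.1)) : B) _ ?_ ?_
      · intro h0
        rw [Ideal.Quotient.eq_zero_iff_mem, RingHom.mem_ker, hx] at h0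
        exact X_ne_zero _ h0
      · change φ _ * _ = φ _
        rw [hx, hy]
    have : Algebra.IsAlgebraic B L := by
      constructor
      intro b
      change _ ∈ Subalgebra.algebraicClosure B L
      induction b using MvPolynomial.induction_on with
      | C a =>
        have : (C a : L) = algebraMap B L (algebraMap K B a) := (ψ.commutes a).symm
        rw [this]
        exact isAlgebraic_algebraMap _
      | add q r hq hr => exact Subalgebra.add_mem _ hq hr
      | mul_X q i hq =>
        refine Subalgebra.mul_mem _ hq ?_
        rcases i with i | i
        · exact hxa i
        · exact hya i
    have h1 := trdeg_add_eq K B (A := L)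
    rw [trdeg_eq_zero (R := B) (A := L), add_zero] at h1
    rw [h1, MvPolynomial.trdeg_of_isDomain, ← Nat.card_sum, ← Nat.cast_card]
    simp

theorem height_main {n : ℕ} {K : Type*} [Field K] (T : Finset (Fin n)) {α : Type} [Finite α]
    (f : {i // i ∉ T} → α) (hf : Function.Surjective f)
    (I : Ideal (MvPolynomial (Fin n ⊕ Fin n) K))
    (hI : ∀ p : Ideal (MvPolynomial (Fin n ⊕ Fin n) K), I ≤ p ↔ Cond T f p) :
    ∃ h : ℕ, heightIdeal I = h ∧ h + (Nat.card {i // i ∉ T} + Nat.card α) = n + n := by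
  obtain ⟨p, hp, hc, ht⟩ := trdeg_lower (K := K) T f hf
  obtain ⟨h, t, hh, ht', hht⟩ := DimF.mv2 n p hp
  rw [ht, Nat.cast_inj] at ht'
  refine ⟨h, heightIdeal_eq I h ?_ ⟨p, hp, (hI p).2 hc, hh.le⟩, by omega⟩
  intro q hq hIq
  obtain ⟨h2, t2, hh2, ht2, hht2⟩ := DimF.mv2 n q hq
  have := trdeg_upper T f q ((hI q).1 hIq)
  rw [ht2, Nat.cast_le] at this
  rw [hh2, Nat.cast_le]
  omega

/-- The component map. -/
def compMap {n : ℕ} (G : SimpleGraph (Fin n)) (S : Finset (Fin n)) (i : {i // i ∉ S}) :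
    (G.induce ((↑S : Set (Fin n))ᶜ)).ConnectedComponent :=
  SimpleGraph.connectedComponentMk _ ⟨i.1, i.2⟩

theorem compMap_eq_iff {n : ℕ} (G : SimpleGraph (Fin n)) (S : Finset (Fin n)) (i j : {i // i ∉ S}) :
    compMap G S i = compMap G S j ↔
      (G.induce ((↑S : Set (Fin n))ᶜ)).Reachable ⟨i.1, i.2⟩ ⟨j.1, j.2⟩ :=
  SimpleGraph.ConnectedComponent.eq

theorem compMap_surj {n : ℕ} (G : SimpleGraph (Fin n)) (S : Finset (Fin n)) :
    Function.Surjective (compMap G S) := by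
  intro c
  induction c using SimpleGraph.ConnectedComponent.ind with
  | h v => exact ⟨⟨v.1, v.2⟩, rfl⟩

theorem PSIdeal_le_iff {n : ℕ} {K : Type*} [Field K] (G : SimpleGraph (Fin n)) (S : Finset (Fin n))
    (p : Ideal (MvPolynomial (Fin n ⊕ Fin n) K)) :
    PSIdeal K G S ≤ p ↔ Cond S (compMap G S) p := by
  unfold PSIdeal Cond
  rw [Ideal.span_le, Set.union_subset_iff, Set.union_subset_iff, Set.image_subset_iff,
    Set.image_subset_iff]
  constructor
  · rintro ⟨⟨h1, h2⟩, h3⟩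
    refine ⟨fun i hi => ⟨h1 hi, h2 hi⟩, fun i j hij => ?_⟩
    exact h3 ⟨i.1, j.1, ⟨i.2, j.2, (compMap_eq_iff G S i j).1 hij⟩, rfl⟩
  · rintro ⟨h1, h2⟩
    refine ⟨⟨fun i hi => (h1 i hi).1, fun i hi => (h1 i hi).2⟩, ?_⟩
    rintro _ ⟨i, j, ⟨hi, hj, hij⟩, rfl⟩
    exact h2 ⟨i, hi⟩ ⟨j, hj⟩ ((compMap_eq_iff G S ⟨i, hi⟩ ⟨j, hj⟩).2 hij)

theorem exists_reach {n : ℕ} (G : SimpleGraph (Fin n)) (S : Finset (Fin n)) (v : Fin n)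
    (hv : v ∉ S) (hlt : numComp G S < numComp G (insert v S)) :
    ∃ w : {i // i ∉ S}, w.1 ≠ v ∧ compMap G S w = compMap G S ⟨v, hv⟩ := by
  by_contra! hcon
  apply absurd hlt
  rw [not_lt]
  have hsub : ∀ i, i ∈ ((↑(insert v S) : Set (Fin n))ᶜ) → i ∈ ((↑S : Set (Fin n))ᶜ) := by
    intro i hi h
    exact hi (by simpa using Or.inr h)
  have key : ∀ a b : ((↑S : Set (Fin n))ᶜ : Set (Fin n)),
      ∀ _ : (G.induce ((↑S : Set (Fin n))ᶜ)).Walk a b, a.1 ≠ v →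
      ∀ (ha : a.1 ∈ ((↑(insert v S) : Set (Fin n))ᶜ)) (hb : b.1 ∈ ((↑(insert v S) : Set (Fin n))ᶜ)),
      (G.induce ((↑(insert v S) : Set (Fin n))ᶜ)).Reachable ⟨a.1, ha⟩ ⟨b.1, hb⟩ := by
    intro a b q
    induction q with
    | nil => intro _ _ _; exact SimpleGraph.Reachable.refl _
    | @cons a c b hac q ih =>
      intro hav ha hb
      have hcv : c.1 ≠ v := by
        intro hc
        apply hcon ⟨a.1, a.2⟩ hav
        rw [compMap_eq_iff]
        have : (⟨v, hv⟩ : ((↑S : Set (Fin n))ᶜ : Set (Fin n))) = c := Subtype.ext hc.symm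
        change (G.induce ((↑S : Set (Fin n))ᶜ)).Reachable a ⟨v, hv⟩
        rw [this]
        exact hac.reachable
      have hc : c.1 ∈ ((↑(insert v S) : Set (Fin n))ᶜ) := by
        intro h
        have h' : c.1 = v ∨ c.1 ∈ S := by simpa using h
        exact h'.elim hcv c.2
      refine SimpleGraph.Reachable.trans (v := ⟨c.1, hc⟩) ?_ (ih hcv hc hb)
      apply SimpleGraph.Adj.reachable
      exact hac
  let F : (G.induce ((↑(insert v S) : Set (Fin n))ᶜ)).ConnectedComponent →
      (G.induce ((↑S : Set (Fin n))ᶜ)).ConnectedComponent :=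
    SimpleGraph.ConnectedComponent.map
      (⟨fun i => ⟨i.1, hsub _ i.2⟩, fun h => h⟩ : (G.induce ((↑(insert v S) : Set (Fin n))ᶜ)) →g _)
  refine Nat.card_le_card_of_injective F ?_
  intro c d
  induction c using SimpleGraph.ConnectedComponent.ind with
  | h a =>
    induction d using SimpleGraph.ConnectedComponent.ind with
    | h b =>
      intro hab
      have h1 : (G.induce ((↑S : Set (Fin n))ᶜ)).Reachable ⟨a.1, hsub _ a.2⟩ ⟨b.1, hsub _ b.2⟩ :=
        SimpleGraph.ConnectedComponent.eq.1 hab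
      obtain ⟨q⟩ := h1
      refine SimpleGraph.ConnectedComponent.eq.2 (key _ _ q ?_ a.2 b.2)
      intro h
      have h' : a.1 = v := h
      exact a.2 (by simp [h'])

theorem stmt16 {n : ℕ} (K : Type*) [Field K] (G : SimpleGraph (Fin n))
    (hunmixed : Unmixed G)
    (S T : Finset (Fin n)) (hS : IsCutSet G S) (hT : IsCutSet G T)
    (hsub : S ⊂ T) (hdiff : (T \ S).card = 1) :
    heightIdeal (PSIdeal K G S + PSIdeal K G T) = heightIdeal (PSIdeal K G S) + 1 := by

  obtain ⟨v, hv⟩ := Finset.card_eq_one.1 hdiff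
  have hvm : v ∈ T \ S := by rw [hv]; exact Finset.mem_singleton_self v
  rw [Finset.mem_sdiff] at hvm
  obtain ⟨hvT, hvS⟩ := hvm
  have hTi : T = insert v S := by
    rw [← Finset.sdiff_union_of_subset hsub.1, hv]; rfl
  have hlt : numComp G S < numComp G (insert v S) := by
    rcases hT with h | ⟨-, h⟩
    · rw [h] at hvT; simp at hvT
    · have := h v hvT
      rw [hTi, Finset.erase_insert hvS] at this
      exact this
  obtain ⟨w, hwv, hw⟩ := exists_reach G S v hvS hlt
  have hST : ∀ i, i ∉ T → i ∉ S := fun i hi h => hi (hsub.1 h)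
  let f' : {i // i ∉ T} → (G.induce ((↑S : Set (Fin n))ᶜ)).ConnectedComponent :=
    fun i => compMap G S ⟨i.1, hST _ i.2⟩
  have hT' : ∀ i, i ∉ S → i ≠ v → i ∉ T := by
    intro i h1 h2 h3
    rw [hTi, Finset.mem_insert] at h3
    exact h3.elim h2 h1
  have hf' : Function.Surjective f' := by
    intro c
    obtain ⟨i, rfl⟩ := compMap_surj G S c
    by_cases hi : i.1 = v
    · refine ⟨⟨w.1, hT' _ w.2 hwv⟩, ?_⟩
      refine hw.trans ?_
      congr 1
      exact Subtype.ext hi.symm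
    · exact ⟨⟨i.1, hT' _ i.2 hi⟩, rfl⟩
  have hI : ∀ p : Ideal (MvPolynomial (Fin n ⊕ Fin n) K),
      PSIdeal K G S + PSIdeal K G T ≤ p ↔ Cond T f' p := by
    intro p
    have hsup : PSIdeal K G S + PSIdeal K G T ≤ p ↔ PSIdeal K G S ≤ p ∧ PSIdeal K G T ≤ p :=
      sup_le_iff
    rw [hsup, PSIdeal_le_iff, PSIdeal_le_iff]
    constructor
    · rintro ⟨⟨h1, h2⟩, ⟨h3, h4⟩⟩
      exact ⟨h3, fun i j hij => h2 ⟨i.1, hST _ i.2⟩ ⟨j.1, hST _ j.2⟩ hij⟩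
    · rintro ⟨h1, h2⟩
      refine ⟨⟨fun i hi => h1 i (hsub.1 hi), fun i j hij => ?_⟩, h1, fun i j hij => h2 i j ?_⟩
      · by_cases hi : i.1 ∈ T
        · exact Ideal.sub_mem _ (Ideal.mul_mem_right _ _ (h1 _ hi).1)
            (Ideal.mul_mem_left _ _ (h1 _ hi).2)
        · by_cases hj : j.1 ∈ T
          · exact Ideal.sub_mem _ (Ideal.mul_mem_left _ _ (h1 _ hj).2)
              (Ideal.mul_mem_right _ _ (h1 _ hj).1)
          · exact h2 ⟨i.1, hi⟩ ⟨j.1, hj⟩ hij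
      · rw [compMap_eq_iff] at hij
        refine (compMap_eq_iff G S ⟨i.1, hST _ i.2⟩ ⟨j.1, hST _ j.2⟩).2 ?_
        exact hij.map (⟨fun i => ⟨i.1, hST _ i.2⟩, fun h => h⟩ :
          (G.induce ((↑T : Set (Fin n))ᶜ)) →g (G.induce ((↑S : Set (Fin n))ᶜ)))
  obtain ⟨a, ha, ha'⟩ := height_main T f' hf' _ hI
  obtain ⟨b, hb, hb'⟩ := height_main (K := K) S (compMap G S) (compMap_surj G S) _
    (PSIdeal_le_iff G S)
  have hc1 : Nat.card {i // i ∉ T} + T.card = n := by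
    have := Finset.card_compl_add_card T
    rw [Nat.card_eq_fintype_card, Fintype.card_subtype_compl]
    have h3 := Finset.card_le_univ T
    simp at h3 ⊢
    omega
  have hc2 : Nat.card {i // i ∉ S} + S.card = n := by
    rw [Nat.card_eq_fintype_card, Fintype.card_subtype_compl]
    have h3 := Finset.card_le_univ S
    simp at h3 ⊢
    omega
  have hc3 : T.card = S.card + 1 := by rw [hTi, Finset.card_insert_of_notMem hvS]
  rw [ha, hb]
  have : a = b + 1 := by omega
  rw [this]
  simp
end
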